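/- arXiv:2004.03382 — 2 statements merged into one kernel-verified Lean document; each statement's English description precedes it below -/
import Mathlib

section
/- There exists an absolute constant C > 0 (independent of the dimension n) such that for every n ≥ 1, every j ∈ {1,…,n}, every λ > 0, every f ∈ L¹(ℝⁿ), and every measurable function g : ℝⁿ → ℝ satisfying g(x) = lim_{ε→0⁺} ∫_{|x−y|≥ε} c_n (x_j − y_j)/|x−y|^{n+1} f(y) dy for Lebesgue-almost every x ∈ ℝⁿ, one has |{x ∈ ℝⁿ : |g(x)| > λ}| ≤ C ( (1/λ)‖f‖_{L¹(ℝⁿ)} + sup_ν |{x ∈ ℝⁿ : |R_jν(x)| > λ}| ), where the supremum is taken over all measures ν = Σ_{k=1}^N a_k δ_{c_k} with N ∈ ℕ, c_k ∈ ℝⁿ, a_k > 0, and Σ_{k=1}^N a_k ≤ 16‖f‖_{L¹(ℝⁿ)}. -/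
open MeasureTheory Filter Set

/-- The normalizing constant of the `j`-th Riesz transform kernel:
`c_n = Γ((n+1)/2) / π^((n+1)/2)`. -/
noncomputable def rieszConst (n : ℕ) : ℝ :=
  Real.Gamma (((n : ℝ) + 1) / 2) / Real.pi ^ (((n : ℝ) + 1) / 2)

/-- The `j`-th Riesz transform of the measure `ν = ∑ₖ aₖ δ_{cₖ}`:
`R_jν(x) = c_n ∑ₖ aₖ (x_j - c_{k,j}) / |x - cₖ|^{n+1}`. -/
noncomputable def rieszDirac (n : ℕ) (j : Fin n) {N : ℕ}
    (c : Fin N → EuclideanSpace ℝ (Fin n)) (a : Fin N → ℝ)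
    (x : EuclideanSpace ℝ (Fin n)) : ℝ :=
  rieszConst n * ∑ k, a k * (x j - c k j) / ‖x - c k‖ ^ (n + 1)

namespace RieszReduction

/-- The convolution kernel of the `j`-th Riesz transform. -/
noncomputable def rieszKernel (n : ℕ) (j : Fin n) (z : EuclideanSpace ℝ (Fin n)) : ℝ :=
  rieszConst n * z j / ‖z‖ ^ (n + 1)

/-- The point of the lattice `δ ℤⁿ` with integer coordinates `k`. -/
noncomputable def gridPoint {n : ℕ} (δ : ℝ) (k : Fin n → ℤ) : EuclideanSpace ℝ (Fin n) :=
  WithLp.toLp 2 fun i => δ * k i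

/-- The integer coordinates of the point of `δ ℤⁿ` nearest to `y`. -/
noncomputable def gridIndex {n : ℕ} (δ : ℝ) (y : EuclideanSpace ℝ (Fin n)) : Fin n → ℤ :=
  fun i => round (y i / δ)

/-- The point of `δ ℤⁿ` nearest to `y`. -/
noncomputable def gridProj {n : ℕ} (δ : ℝ) (y : EuclideanSpace ℝ (Fin n)) :
    EuclideanSpace ℝ (Fin n) :=
  gridPoint δ (gridIndex δ y)

/-- The reflection of each cell of `δ ℤⁿ` through its centre. -/
noncomputable def gridReflect {n : ℕ} (δ : ℝ) (y : EuclideanSpace ℝ (Fin n)) :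
    EuclideanSpace ℝ (Fin n) :=
  gridProj δ y + gridProj δ y - y

variable {n : ℕ} {j : Fin n} {δ : ℝ}

lemma rieszConst_pos (n : ℕ) : 0 < rieszConst n :=
  div_pos (Real.Gamma_pos_of_pos (by positivity)) (Real.rpow_pos_of_pos Real.pi_pos _)

lemma rieszKernel_neg (z : EuclideanSpace ℝ (Fin n)) :
    rieszKernel n j (-z) = -rieszKernel n j z := by
  simp [rieszKernel, neg_div]

lemma measurable_rieszKernel : Measurable (rieszKernel n j) := by
  unfold rieszKernel
  fun_prop

lemma abs_rieszKernel_le {z : EuclideanSpace ℝ (Fin n)} {r : ℝ} (hr : 0 < r) (hz : r ≤ ‖z‖) :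
    |rieszKernel n j z| ≤ rieszConst n / r ^ n := by
  have hz0 : 0 < ‖z‖ := hr.trans_le hz
  have hc := (rieszConst_pos n).le
  have hj : |z j| ≤ ‖z‖ := PiLp.norm_apply_le z j
  rw [rieszKernel, abs_div, abs_mul, abs_of_nonneg hc, abs_of_pos (pow_pos hz0 _)]
  calc rieszConst n * |z j| / ‖z‖ ^ (n + 1) ≤ rieszConst n * ‖z‖ / ‖z‖ ^ (n + 1) := by gcongr
    _ = rieszConst n / ‖z‖ ^ n := by field_simp; ring
    _ ≤ _ := by gcongr

lemma abs_rieszKernel_sub_le {z w : EuclideanSpace ℝ (Fin n)} {r : ℝ} (hr : 0 < r)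
    (hz : r ≤ ‖z‖) (hw : r ≤ ‖w‖) (hzr : ‖z‖ ≤ 4 * r) (hwr : ‖w‖ ≤ 4 * r) :
    |rieszKernel n j z - rieszKernel n j w| ≤
      rieszConst n * (1 + (n + 1) * 4 ^ (n + 1)) * ‖z - w‖ / r ^ (n + 1) := by
  have hz0 : 0 < ‖z‖ := hr.trans_le hz
  have hw0 : 0 < ‖w‖ := hr.trans_le hw
  have hc := (rieszConst_pos n).le
  have hj : |w j| ≤ ‖w‖ := PiLp.norm_apply_le w j
  have hd : |z j - w j| ≤ ‖z - w‖ := PiLp.norm_apply_le (z - w) j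
  have hpow : |‖w‖ ^ (n + 1) - ‖z‖ ^ (n + 1)| ≤ ‖z - w‖ * (n + 1) * (4 * r) ^ n := by
    refine (abs_pow_sub_pow_le _ _ _).trans ?_
    have h1 : |‖w‖ - ‖z‖| ≤ ‖z - w‖ := by
      rw [norm_sub_rev]; exact abs_norm_sub_norm_le w z
    have h2 : max |‖w‖| |‖z‖| ≤ 4 * r := by
      rw [abs_norm, abs_norm]; exact max_le hwr hzr
    push_cast
    gcongr
  have key : rieszKernel n j z - rieszKernel n j w = rieszConst n *
      ((z j - w j) / ‖z‖ ^ (n + 1) +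
        w j * (‖w‖ ^ (n + 1) - ‖z‖ ^ (n + 1)) / (‖z‖ ^ (n + 1) * ‖w‖ ^ (n + 1))) := by
    unfold rieszKernel
    field_simp
    ring
  have hA : |(z j - w j) / ‖z‖ ^ (n + 1)| ≤ ‖z - w‖ / r ^ (n + 1) := by
    rw [abs_div, abs_of_pos (pow_pos hz0 _)]
    gcongr
  have hB : |w j * (‖w‖ ^ (n + 1) - ‖z‖ ^ (n + 1)) / (‖z‖ ^ (n + 1) * ‖w‖ ^ (n + 1))| ≤
      (n + 1) * 4 ^ (n + 1) * ‖z - w‖ / r ^ (n + 1) := by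
    rw [abs_div, abs_mul, abs_of_pos (mul_pos (pow_pos hz0 (n + 1)) (pow_pos hw0 (n + 1)))]
    calc |w j| * |‖w‖ ^ (n + 1) - ‖z‖ ^ (n + 1)| / (‖z‖ ^ (n + 1) * ‖w‖ ^ (n + 1))
        ≤ (4 * r) * (‖z - w‖ * (n + 1) * (4 * r) ^ n) / (r ^ (n + 1) * r ^ (n + 1)) := by
          gcongr
          exact hj.trans hwr
      _ = _ := by field_simp; ring
  rw [key, abs_mul, abs_of_nonneg hc]
  calc _ ≤ rieszConst n * (‖z - w‖ / r ^ (n + 1) +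
        (n + 1) * 4 ^ (n + 1) * ‖z - w‖ / r ^ (n + 1)) := by
        gcongr
        exact (abs_add_le _ _).trans (add_le_add hA hB)
    _ = _ := by ring

@[simp] lemma gridPoint_apply (δ : ℝ) (k : Fin n → ℤ) (i : Fin n) :
    gridPoint δ k i = δ * k i := rfl

lemma abs_sub_gridProj_apply_le (hδ : 0 < δ) (y : EuclideanSpace ℝ (Fin n)) (i : Fin n) :
    |y i - gridProj δ y i| ≤ δ / 2 := by
  have h := abs_sub_round (y i / δ)
  have : y i - gridProj δ y i = δ * (y i / δ - round (y i / δ)) := by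
    simp only [gridProj, gridPoint_apply, gridIndex]
    field_simp
  rw [this, abs_mul, abs_of_pos hδ]
  linarith [mul_le_mul_of_nonneg_left h hδ.le]

lemma norm_le_card_mul {z : EuclideanSpace ℝ (Fin n)} {r : ℝ} (hr : 0 ≤ r) (h : ∀ i, |z i| ≤ r) :
    ‖z‖ ≤ n * r := by
  rw [EuclideanSpace.norm_eq]
  refine Real.sqrt_le_iff.2 ⟨by positivity, ?_⟩
  have hle : ∀ i ∈ Finset.univ, ‖z i‖ ^ 2 ≤ r ^ 2 := fun i _ => by
    rw [Real.norm_eq_abs]; gcongr; exact h i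
  have hn : (n : ℝ) ≤ n ^ 2 := by exact_mod_cast Nat.le_self_pow two_ne_zero n
  calc _ ≤ ∑ _i : Fin n, r ^ 2 := Finset.sum_le_sum hle
    _ = n * r ^ 2 := by simp
    _ ≤ n ^ 2 * r ^ 2 := by gcongr
    _ = _ := by ring

lemma norm_sub_gridProj_le (hδ : 0 < δ) (y : EuclideanSpace ℝ (Fin n)) :
    ‖y - gridProj δ y‖ ≤ n * δ := by
  refine (norm_le_card_mul (r := δ / 2) (by positivity)
    fun i => abs_sub_gridProj_apply_le hδ y i).trans ?_
  gcongr
  linarith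

lemma half_le_norm_sub_gridPoint (hδ : 0 < δ) {z : EuclideanSpace ℝ (Fin n)} {k l : Fin n → ℤ}
    (hz : ∀ i, |z i - δ * k i| ≤ δ / 2) (hkl : l ≠ k) : δ / 2 ≤ ‖z - gridPoint δ l‖ := by
  obtain ⟨i, hi⟩ := Function.ne_iff.1 hkl
  have h1 : (1 : ℝ) ≤ |(k i : ℝ) - l i| := by
    exact_mod_cast Int.one_le_abs (sub_ne_zero.2 hi.symm)
  have h2 : |z i - δ * l i| ≤ ‖z - gridPoint δ l‖ := PiLp.norm_apply_le (z - gridPoint δ l) i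
  have h3 : |δ * k i - δ * l i| = δ * |(k i : ℝ) - l i| := by
    rw [← mul_sub, abs_mul, abs_of_pos hδ]
  have h4 := abs_sub_le (δ * k i : ℝ) (z i) (δ * l i)
  rw [abs_sub_comm (δ * k i : ℝ) (z i)] at h4
  nlinarith [hz i]

lemma abs_gridReflect_sub_apply_le (hδ : 0 < δ) (y : EuclideanSpace ℝ (Fin n)) (i : Fin n) :
    |gridReflect δ y i - gridProj δ y i| ≤ δ / 2 := by
  have : gridReflect δ y i - gridProj δ y i = -(y i - gridProj δ y i) := by
    simp only [gridReflect, PiLp.sub_apply, PiLp.add_apply]; ring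
  rw [this, abs_neg]
  exact abs_sub_gridProj_apply_le hδ y i

lemma measurable_gridIndex (δ : ℝ) :
    Measurable (gridIndex δ : EuclideanSpace ℝ (Fin n) → Fin n → ℤ) := by
  unfold gridIndex
  simp only [round_eq]
  fun_prop

lemma measurable_gridProj (δ : ℝ) :
    Measurable (gridProj δ : EuclideanSpace ℝ (Fin n) → EuclideanSpace ℝ (Fin n)) :=
  (measurable_of_countable fun k : Fin n → ℤ => gridPoint δ k).comp (measurable_gridIndex δ)

lemma gridReflect_unique (hδ : 0 < δ) {k l : Fin n → ℤ} {y : EuclideanSpace ℝ (Fin n)}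
    (hk : gridIndex δ (gridPoint δ k + gridPoint δ k - y) = k)
    (hl : gridIndex δ (gridPoint δ l + gridPoint δ l - y) = l) : k = l := by
  funext i
  have aux : ∀ m : Fin n → ℤ, gridIndex δ (gridPoint δ m + gridPoint δ m - y) = m →
      (m i : ℝ) - 1 / 2 < y i / δ ∧ y i / δ ≤ m i + 1 / 2 := by
    intro m hm
    have h := congrFun hm i
    have h2 : (gridPoint δ m + gridPoint δ m - y) i / δ = 2 * m i - y i / δ := by
      simp only [PiLp.sub_apply, PiLp.add_apply, gridPoint_apply]
      field_simp
      ring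
    rw [gridIndex, h2, round_eq_iff] at h
    constructor <;> linarith [h.1, h.2]
  have h1 := aux k hk
  have h2 := aux l hl
  have h3 : (k i : ℝ) < l i + 1 := by linarith
  have h4 : (l i : ℝ) < k i + 1 := by linarith
  have h5 : k i < l i + 1 := by exact_mod_cast h3
  have h6 : l i < k i + 1 := by exact_mod_cast h4
  lia

lemma volume_preimage_gridReflect_le (hδ : 0 < δ) (S : Set (EuclideanSpace ℝ (Fin n))) :
    volume (gridReflect δ ⁻¹' S) ≤ volume S := by
  let r : (Fin n → ℤ) → EuclideanSpace ℝ (Fin n) ≃ᵐ EuclideanSpace ℝ (Fin n) := fun k =>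
    MeasurableEquiv.subLeft (gridPoint δ k + gridPoint δ k)
  have hr : ∀ k y, r k y = gridPoint δ k + gridPoint δ k - y := fun _ _ => rfl
  let A : (Fin n → ℤ) → Set (EuclideanSpace ℝ (Fin n)) := fun k => {y | gridIndex δ (r k y) = k}
  have hA : ∀ k, MeasurableSet (A k) := fun k =>
    ((measurable_gridIndex δ).comp (r k).measurable) (measurableSet_singleton k)
  have hdisj : Pairwise (Function.onFun Disjoint A) := by
    intro k l hkl
    refine Set.disjoint_left.2 fun y hk hl => hkl (gridReflect_unique hδ hk hl)
  have hsub : gridReflect δ ⁻¹' S ⊆ ⋃ k, r k ⁻¹' (A k ∩ S) := by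
    intro y hy
    refine Set.mem_iUnion.2 ⟨gridIndex δ y, ?_, hy⟩
    simp [A, hr]
  calc volume (gridReflect δ ⁻¹' S) ≤ ∑' k, volume (r k ⁻¹' (A k ∩ S)) :=
        (measure_mono hsub).trans (measure_iUnion_le _)
    _ = ∑' k, volume.restrict S (A k) := by
        congr 1
        funext k
        rw [Measure.restrict_apply (hA k)]
        have hk : MeasurePreserving (r k) volume volume :=
          Measure.measurePreserving_sub_left volume (gridPoint δ k + gridPoint δ k)
        exact hk.measure_preimage_equiv _
    _ = volume.restrict S (⋃ k, A k) := (measure_iUnion hdisj hA).symm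
    _ ≤ volume S := (measure_mono (Set.subset_univ _)).trans_eq (by simp)

lemma measure_lt_abs_le_of_tendsto {α : Type*} [MeasurableSpace α] {μ : Measure α}
    {h : ℕ → α → ℝ} {g : α → ℝ} {lam : ℝ} {B : ENNReal}
    (hlim : ∀ᵐ x ∂μ, Tendsto (fun m => h m x) atTop (nhds (g x)))
    (hB : ∀ m, μ {x | lam < |h m x|} ≤ B) : μ {x | lam < |g x|} ≤ B := by
  let V : ℕ → Set α := fun N => {x | ∀ m, N ≤ m → lam < |h m x|}
  have hV : Monotone V := fun a b hab x hx m hm => hx m (hab.trans hm)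
  calc μ {x | lam < |g x|} ≤ μ (⋃ N, V N) := by
        refine measure_mono_ae ?_
        filter_upwards [hlim] with x hx hgx
        obtain ⟨N, hN⟩ := eventually_atTop.1 (hx.abs.eventually_const_lt hgx)
        exact Set.mem_iUnion.2 ⟨N, hN⟩
    _ = ⨆ N, μ (V N) := hV.measure_iUnion
    _ ≤ B := iSup_le fun N =>
      (measure_mono (t := {x | lam < |h N x|}) fun x (hx : x ∈ V N) => hx N le_rfl).trans (hB N)

lemma exists_rieszDirac_eq_setIntegral {h : EuclideanSpace ℝ (Fin n) → ℝ}
    (hh : Integrable h volume) (h0 : ∀ y, 0 ≤ h y) (δ : ℝ) (s : Finset (Fin n → ℤ)) :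
    ∃ (N : ℕ) (c : Fin N → EuclideanSpace ℝ (Fin n)) (a : Fin N → ℝ),
      (∀ k, 0 < a k) ∧ ∑ k, a k ≤ ∫ y, h y ∧
      ∀ x, rieszDirac n j c a x =
        ∫ y in gridIndex δ ⁻¹' s, rieszKernel n j (x - gridProj δ y) * h y := by
  classical
  let cell : (Fin n → ℤ) → Set (EuclideanSpace ℝ (Fin n)) := fun k => gridIndex δ ⁻¹' {k}
  have hcell : ∀ k, MeasurableSet (cell k) := fun k =>
    measurable_gridIndex δ (measurableSet_singleton k)
  have hdisj : ∀ t : Finset (Fin n → ℤ), (t : Set (Fin n → ℤ)).Pairwise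
      (Function.onFun Disjoint cell) := fun t k _ l _ hkl =>
    Set.disjoint_left.2 fun y hk hl => hkl (hk.symm.trans hl)
  let b : (Fin n → ℤ) → ℝ := fun k => ∫ y in cell k, h y
  have hb : ∀ k, 0 ≤ b k := fun k => setIntegral_nonneg (hcell k) fun y _ => h0 y
  let t : Finset (Fin n → ℤ) := s.filter fun k => b k ≠ 0
  refine ⟨t.card, fun i => gridPoint δ (t.equivFin.symm i), fun i => b (t.equivFin.symm i),
    fun i => ?_, ?_, fun x => ?_⟩
  · exact (hb _).lt_of_ne' (Finset.mem_filter.1 (t.equivFin.symm i).2).2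
  · rw [Equiv.sum_comp t.equivFin.symm fun k : t => b k, Finset.sum_coe_sort t b,
      ← integral_biUnion_finset t (fun k _ => hcell k) (hdisj t) fun k _ => hh.integrableOn]
    exact setIntegral_le_integral hh (ae_of_all _ h0)
  · have hU : gridIndex δ ⁻¹' (s : Set (Fin n → ℤ)) = ⋃ k ∈ s, cell k := by
      ext y; simp [cell]
    have hEq : ∀ k, EqOn (fun y => rieszKernel n j (x - gridProj δ y) * h y)
        (fun y => rieszKernel n j (x - gridPoint δ k) * h y) (cell k) := by
      intro k y hy
      have : gridIndex δ y = k := hy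
      simp only [gridProj, this]
    rw [hU, integral_biUnion_finset s (fun k _ => hcell k) (hdisj s) fun k _ =>
      ((hh.const_mul _).integrableOn.congr_fun (hEq k).symm (hcell k))]
    have hterm : ∀ k, ∫ y in cell k, rieszKernel n j (x - gridProj δ y) * h y =
        rieszKernel n j (x - gridPoint δ k) * b k := fun k => by
      rw [setIntegral_congr_fun (hcell k) (hEq k), integral_const_mul]
    have hfil : ∑ k ∈ t, rieszKernel n j (x - gridPoint δ k) * b k =
        ∑ k ∈ s, rieszKernel n j (x - gridPoint δ k) * b k :=
      Finset.sum_filter_of_ne fun k _ hk => right_ne_zero_of_mul hk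
    simp only [hterm]
    rw [← hfil, rieszDirac, Finset.mul_sum, ← Finset.sum_coe_sort t,
      ← Equiv.sum_comp t.equivFin.symm]
    refine Finset.sum_congr rfl fun i _ => ?_
    simp only [rieszKernel, PiLp.sub_apply]
    ring

/-- The Riesz transform of the measure obtained from `f` by moving the mass of each cell of
`δ ℤⁿ` to the centre of the cell. -/
noncomputable def gridRiesz {n : ℕ} (j : Fin n) (δ : ℝ) (f : EuclideanSpace ℝ (Fin n) → ℝ)
    (x : EuclideanSpace ℝ (Fin n)) : ℝ :=
  ∫ y, rieszKernel n j (x - gridProj δ y) * f y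

lemma abs_rieszKernel_sub_gridProj_le (hδ : 0 < δ) {z : EuclideanSpace ℝ (Fin n)} {k : Fin n → ℤ}
    (hz : ∀ i, |z i - δ * k i| ≤ δ / 2) (y : EuclideanSpace ℝ (Fin n)) :
    |rieszKernel n j (z - gridProj δ y)| ≤
      |rieszKernel n j (z - gridPoint δ k)| + rieszConst n / (δ / 2) ^ n := by
  have hc := (rieszConst_pos n).le
  by_cases hk : gridIndex δ y = k
  · rw [gridProj, hk]
    exact le_add_of_nonneg_right (by positivity)
  · exact (abs_rieszKernel_le (by positivity) (half_le_norm_sub_gridPoint hδ hz hk)).trans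
      (le_add_of_nonneg_left (abs_nonneg _))

lemma integrable_rieszKernel_sub_gridProj_mul (hδ : 0 < δ) {f : EuclideanSpace ℝ (Fin n) → ℝ}
    (hf : Integrable f volume) (x : EuclideanSpace ℝ (Fin n)) :
    Integrable (fun y => rieszKernel n j (x - gridProj δ y) * f y) volume :=
  hf.bdd_mul (measurable_rieszKernel.comp
    ((measurable_gridProj δ).const_sub x)).aestronglyMeasurable
    (ae_of_all _ fun y => abs_rieszKernel_sub_gridProj_le hδ (k := gridIndex δ x)
      (fun i => abs_sub_gridProj_apply_le hδ x i) y)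

section WeakType

variable {lam M : ℝ} {B : ENNReal}

lemma volume_gridRiesz_le_of_nonneg
    (hB : ∀ (N : ℕ) (c : Fin N → EuclideanSpace ℝ (Fin n)) (a : Fin N → ℝ), (∀ k, 0 < a k) →
      ∑ k, a k ≤ M → volume {x | lam < |rieszDirac n j c a x|} ≤ B)
    (hδ : 0 < δ) {h : EuclideanSpace ℝ (Fin n) → ℝ} (hh : Integrable h volume)
    (h0 : ∀ y, 0 ≤ h y) (hM : ∫ y, h y ≤ M) :
    volume {x | lam < |gridRiesz j δ h x|} ≤ B := by
  let s : ℕ → Finset (Fin n → ℤ) := fun m => Fintype.piFinset fun _ => Finset.Icc (-m : ℤ) m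
  have hcover : AECover (volume : Measure (EuclideanSpace ℝ (Fin n))) atTop
      fun m => gridIndex δ ⁻¹' (s m : Set (Fin n → ℤ)) := by
    refine ⟨ae_of_all _ fun y => ?_, fun m => measurable_gridIndex δ (Finset.measurableSet _)⟩
    filter_upwards [eventually_ge_atTop (∑ i, (gridIndex δ y i).natAbs)] with m hm
    simp only [s, Set.mem_preimage, Finset.mem_coe, Fintype.mem_piFinset, Finset.mem_Icc]
    intro i
    have := Finset.single_le_sum (f := fun i => (gridIndex δ y i).natAbs)
      (fun i _ => Nat.zero_le _) (Finset.mem_univ i)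
    lia
  refine measure_lt_abs_le_of_tendsto (ae_of_all _ fun x =>
    hcover.integral_tendsto_of_countably_generated
      (integrable_rieszKernel_sub_gridProj_mul hδ hh x)) fun m => ?_
  obtain ⟨N, c, a, ha, hsum, hac⟩ := exists_rieszDirac_eq_setIntegral (j := j) hh h0 δ (s m)
  simp only [← hac]
  exact hB N c a ha (hsum.trans hM)

lemma volume_gridRiesz_le
    (hB : ∀ (N : ℕ) (c : Fin N → EuclideanSpace ℝ (Fin n)) (a : Fin N → ℝ), (∀ k, 0 < a k) →
      ∑ k, a k ≤ M → volume {x | lam < |rieszDirac n j c a x|} ≤ B)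
    (hδ : 0 < δ) {f : EuclideanSpace ℝ (Fin n) → ℝ} (hf : Integrable f volume)
    (hM : 2 * ∫ y, |f y| ≤ M) :
    volume {x | lam < |gridRiesz j δ f x|} ≤ 2 * B := by
  have hpos : Integrable (fun y => 2 * max (f y) 0) volume := hf.pos_part.const_mul 2
  have hneg : Integrable (fun y => 2 * max (-f y) 0) volume := hf.neg_part.const_mul 2
  have hmass : ∀ h : EuclideanSpace ℝ (Fin n) → ℝ, Integrable h volume → (∀ y, h y ≤ 2 * |f y|) →
      ∫ y, h y ≤ M := fun h hh hle => by
    refine (integral_mono hh (hf.abs.const_mul 2) hle).trans ?_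
    rwa [integral_const_mul]
  have h1 := volume_gridRiesz_le_of_nonneg hB hδ hpos (fun y => by positivity)
    (hmass _ hpos fun y => by
      have := max_le (le_abs_self (f y)) (abs_nonneg (f y)); linarith)
  have h2 := volume_gridRiesz_le_of_nonneg hB hδ hneg (fun y => by positivity)
    (hmass _ hneg fun y => by
      have := max_le (neg_le_abs (f y)) (abs_nonneg (f y)); linarith)
  have hsub : {x | lam < |gridRiesz j δ f x|} ⊆
      {x | lam < |gridRiesz j δ (fun y => 2 * max (f y) 0) x|} ∪
      {x | lam < |gridRiesz j δ (fun y => 2 * max (-f y) 0) x|} := by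
    intro x hx
    have hsplit : 2 * gridRiesz j δ f x = gridRiesz j δ (fun y => 2 * max (f y) 0) x -
        gridRiesz j δ (fun y => 2 * max (-f y) 0) x := by
      unfold gridRiesz
      rw [← integral_sub (integrable_rieszKernel_sub_gridProj_mul hδ hpos x)
        (integrable_rieszKernel_sub_gridProj_mul hδ hneg x), ← integral_const_mul]
      congr 1
      funext y
      have : max (f y) 0 - max (-f y) 0 = f y := by
        rcases le_total 0 (f y) with h | h <;> simp [h]
      linear_combination (-2 * rieszKernel n j (x - gridProj δ y)) * this
    have hx' : lam < |gridRiesz j δ f x| := hx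
    by_contra hcon
    simp only [Set.mem_union, Set.mem_ofPred_eq, not_or, not_lt] at hcon
    have := abs_sub (gridRiesz j δ (fun y => 2 * max (f y) 0) x)
      (gridRiesz j δ (fun y => 2 * max (-f y) 0) x)
    rw [← hsplit, abs_mul, abs_two] at this
    linarith [hcon.1, hcon.2]
  calc _ ≤ _ := measure_mono hsub
    _ ≤ B + B := (measure_union_le _ _).trans (add_le_add h1 h2)
    _ = 2 * B := (two_mul B).symm

lemma volume_gridRiesz_add_reflect_le
    (hB : ∀ (N : ℕ) (c : Fin N → EuclideanSpace ℝ (Fin n)) (a : Fin N → ℝ), (∀ k, 0 < a k) →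
      ∑ k, a k ≤ M → volume {x | lam < |rieszDirac n j c a x|} ≤ B)
    (hδ : 0 < δ) {f : EuclideanSpace ℝ (Fin n) → ℝ} (hf : Integrable f volume)
    (hM : 2 * ∫ y, |f y| ≤ M) :
    volume {x | 2 * lam < |gridRiesz j δ f x + gridRiesz j δ f (gridReflect δ x)|} ≤ 4 * B := by
  have h := volume_gridRiesz_le hB hδ hf hM
  have hsub : {x | 2 * lam < |gridRiesz j δ f x + gridRiesz j δ f (gridReflect δ x)|} ⊆
      {x | lam < |gridRiesz j δ f x|} ∪ gridReflect δ ⁻¹' {x | lam < |gridRiesz j δ f x|} := by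
    intro x hx
    have hx' : 2 * lam < |gridRiesz j δ f x + gridRiesz j δ f (gridReflect δ x)| := hx
    by_contra hcon
    simp only [Set.mem_union, Set.mem_preimage, Set.mem_ofPred_eq, not_or, not_lt] at hcon
    linarith [abs_add_le (gridRiesz j δ f x) (gridRiesz j δ f (gridReflect δ x)), hcon.1, hcon.2]
  calc _ ≤ _ := measure_mono hsub
    _ ≤ 2 * B + 2 * B := (measure_union_le _ _).trans
        (add_le_add h ((volume_preimage_gridReflect_le hδ _).trans h))
    _ = 4 * B := by rw [← add_mul]; norm_num

end WeakType

/-- The Riesz kernel truncated at distance `δ` from the origin. -/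
noncomputable def truncKernel (n : ℕ) (j : Fin n) (δ : ℝ) (z : EuclideanSpace ℝ (Fin n)) : ℝ :=
  {z | δ ≤ ‖z‖}.indicator (rieszKernel n j) z

/-- The kernel of the operator `f ↦ gridRiesz j δ f x + gridRiesz j δ f (gridReflect δ x)`. -/
noncomputable def symmKernel {n : ℕ} (j : Fin n) (δ : ℝ) (x y : EuclideanSpace ℝ (Fin n)) : ℝ :=
  rieszKernel n j (x - gridProj δ y) + rieszKernel n j (gridReflect δ x - gridProj δ y)

lemma measurable_truncKernel : Measurable (truncKernel n j δ) :=
  measurable_rieszKernel.indicator (measurableSet_le measurable_const measurable_norm)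

lemma truncKernel_neg (z : EuclideanSpace ℝ (Fin n)) :
    truncKernel n j δ (-z) = -truncKernel n j δ z := by
  by_cases h : δ ≤ ‖z‖ <;> simp [truncKernel, Set.indicator, h, rieszKernel_neg]

lemma abs_truncKernel_le (hδ : 0 < δ) (z : EuclideanSpace ℝ (Fin n)) :
    |truncKernel n j δ z| ≤ rieszConst n / δ ^ n := by
  have hc := (rieszConst_pos n).le
  by_cases h : δ ≤ ‖z‖
  · simpa [truncKernel, Set.indicator, h] using abs_rieszKernel_le (j := j) hδ h
  · simp only [truncKernel, Set.indicator, Set.mem_ofPred_eq, h, if_false, abs_zero]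
    positivity

lemma measurable_symmKernel (x : EuclideanSpace ℝ (Fin n)) : Measurable (symmKernel j δ x) :=
  (measurable_rieszKernel.comp ((measurable_gridProj δ).const_sub _)).add
    (measurable_rieszKernel.comp ((measurable_gridProj δ).const_sub _))

lemma abs_symmKernel_le (hδ : 0 < δ) (x y : EuclideanSpace ℝ (Fin n)) :
    |symmKernel j δ x y| ≤ 2 * (rieszConst n / (δ / 2) ^ n) := by
  have hc := (rieszConst_pos n).le
  by_cases hk : gridIndex δ y = gridIndex δ x
  · have hp : gridProj δ y = gridProj δ x := by rw [gridProj, hk, gridProj]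
    have hr : gridReflect δ x - gridProj δ x = -(x - gridProj δ x) := by
      rw [gridReflect]; abel
    rw [symmKernel, hp, hr, rieszKernel_neg, add_neg_cancel, abs_zero]
    positivity
  · rw [two_mul]
    exact (abs_add_le _ _).trans (add_le_add
      (abs_rieszKernel_le (by positivity) (half_le_norm_sub_gridPoint hδ
        (fun i => abs_sub_gridProj_apply_le hδ x i) hk))
      (abs_rieszKernel_le (by positivity) (half_le_norm_sub_gridPoint hδ
        (fun i => abs_gridReflect_sub_apply_le hδ x i) hk)))

lemma norm_sub_gridProj_sub_le (hδ : 0 < δ) (x y : EuclideanSpace ℝ (Fin n)) :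
    ‖(x - gridProj δ y) - (x - y)‖ ≤ 3 * n * δ := by
  have h : (x - gridProj δ y) - (x - y) = y - gridProj δ y := by abel
  rw [h]
  have : 0 ≤ n * δ := by positivity
  linarith [norm_sub_gridProj_le hδ y]

lemma norm_gridReflect_sub_gridProj_sub_le (hδ : 0 < δ) (x y : EuclideanSpace ℝ (Fin n)) :
    ‖(gridReflect δ x - gridProj δ y) - (x - y)‖ ≤ 3 * n * δ := by
  have h : (gridReflect δ x - gridProj δ y) - (x - y) =
      (y - gridProj δ y) - (x - gridProj δ x) - (x - gridProj δ x) := by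
    rw [gridReflect]; abel
  rw [h]
  have h1 := norm_sub_le ((y - gridProj δ y) - (x - gridProj δ x)) (x - gridProj δ x)
  have h2 := norm_sub_le (y - gridProj δ y) (x - gridProj δ x)
  linarith [norm_sub_gridProj_le hδ y, norm_sub_gridProj_le hδ x]

lemma exists_abs_symmKernel_sub_truncKernel_le (n : ℕ) (j : Fin n) :
    ∃ C : ℝ, 0 ≤ C ∧ ∀ δ : ℝ, 0 < δ → ∀ x y : EuclideanSpace ℝ (Fin n),
      |symmKernel j δ x y - 2 * truncKernel n j δ (x - y)| ≤
        C * (δ / (δ + ‖x - y‖) ^ (n + 1)) := by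
  have hc := (rieszConst_pos n).le
  set D : ℝ := rieszConst n * (1 + (n + 1) * 4 ^ (n + 1)) with hD
  have hD0 : 0 ≤ D := by positivity
  set C₁ : ℝ := (2 * rieszConst n * 2 ^ n + 2 * rieszConst n) * (6 * n + 2) ^ (n + 1) with hC₁
  set C₂ : ℝ := 2 * (D * (3 * n)) * 4 ^ (n + 1) with hC₂
  have hC₁0 : 0 ≤ C₁ := by positivity
  have hC₂0 : 0 ≤ C₂ := by positivity
  refine ⟨C₁ + C₂, by positivity, fun δ hδ x y => ?_⟩
  set s := ‖x - y‖ with hs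
  have hs0 : 0 ≤ s := norm_nonneg _
  have hP : 0 ≤ δ / (δ + s) ^ (n + 1) := by positivity
  rcases lt_or_ge s ((6 * n + 1) * δ) with hnear | hfar
  · refine le_trans ?_ (mul_le_mul_of_nonneg_right (le_add_of_nonneg_right hC₂0) hP)
    have h1 := abs_symmKernel_le (j := j) hδ x y
    have h2 := abs_truncKernel_le (j := j) hδ (x - y)
    have h3 := abs_sub (symmKernel j δ x y) (2 * truncKernel n j δ (x - y))
    rw [abs_mul, abs_two] at h3
    calc _ ≤ 2 * (rieszConst n / (δ / 2) ^ n) + 2 * (rieszConst n / δ ^ n) := by linarith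
      _ = C₁ * (δ / ((6 * n + 2) * δ) ^ (n + 1)) := by
        rw [hC₁, div_pow, mul_pow]; field_simp; ring
      _ ≤ _ := by gcongr; linarith
  · refine le_trans ?_ (mul_le_mul_of_nonneg_right (le_add_of_nonneg_left hC₁0) hP)
    have hδs : δ ≤ s := by
      have : 0 ≤ n * δ := by positivity
      linarith
    have hspos : 0 < s := hδ.trans_le hδs
    have htr : truncKernel n j δ (x - y) = rieszKernel n j (x - y) :=
      Set.indicator_of_mem (s := {z : EuclideanSpace ℝ (Fin n) | δ ≤ ‖z‖}) hδs _
    have aux : ∀ z : EuclideanSpace ℝ (Fin n), ‖z - (x - y)‖ ≤ 3 * n * δ →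
        |rieszKernel n j z - rieszKernel n j (x - y)| ≤ D * (3 * n * δ) / (s / 2) ^ (n + 1) := by
      intro z hz
      have hz1 : ‖z - (x - y)‖ ≤ s / 2 := by linarith
      have hz2 := norm_sub_norm_le z (x - y)
      have hz3 := norm_sub_norm_le (x - y) z
      rw [norm_sub_rev (x - y) z] at hz3
      refine (abs_rieszKernel_sub_le (r := s / 2) (by positivity) (by linarith) (by linarith)
        (by linarith) (by linarith)).trans ?_
      gcongr
    have h1 := aux _ (norm_sub_gridProj_sub_le hδ x y)
    have h2 := aux _ (norm_gridReflect_sub_gridProj_sub_le hδ x y)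
    have h3 : symmKernel j δ x y - 2 * truncKernel n j δ (x - y) =
        (rieszKernel n j (x - gridProj δ y) - rieszKernel n j (x - y)) +
        (rieszKernel n j (gridReflect δ x - gridProj δ y) - rieszKernel n j (x - y)) := by
      rw [htr, symmKernel]; ring
    calc _ ≤ D * (3 * n * δ) / (s / 2) ^ (n + 1) + D * (3 * n * δ) / (s / 2) ^ (n + 1) := by
          rw [h3]; exact (abs_add_le _ _).trans (add_le_add h1 h2)
      _ = C₂ * (δ / (2 * s) ^ (n + 1)) := by
        have h4 : (4 : ℝ) ^ (n + 1) = 2 ^ (n + 1) * 2 ^ (n + 1) := by rw [← mul_pow]; norm_num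
        rw [hC₂, div_pow, mul_pow, h4]; field_simp; ring
      _ ≤ _ := by gcongr; linarith

lemma exists_poissonKernel_le_dyadic (n : ℕ) (hδ : 0 < δ) {s : ℝ} (hs : 0 ≤ s) :
    ∃ i : ℕ, s ≤ 2 ^ i * δ ∧ δ / (δ + s) ^ (n + 1) ≤
      2 ^ (n + 1) * (1 / 2) ^ i * ((2 ^ i * δ) ^ n)⁻¹ := by
  classical
  have hex : ∃ i : ℕ, s ≤ 2 ^ i * δ := by
    obtain ⟨i, hi⟩ := pow_unbounded_of_one_lt (s / δ) (one_lt_two : (1 : ℝ) < 2)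
    exact ⟨i, (div_le_iff₀ hδ).1 hi.le⟩
  refine ⟨Nat.find hex, Nat.find_spec hex, ?_⟩
  rcases hi : Nat.find hex with _ | i
  · have h1 : (1 : ℝ) ≤ 2 ^ (n + 1) := one_le_pow₀ one_le_two
    calc δ / (δ + s) ^ (n + 1) ≤ δ / δ ^ (n + 1) := by gcongr; linarith
      _ = 1 * (δ ^ n)⁻¹ := by field_simp; ring
      _ ≤ 2 ^ (n + 1) * (δ ^ n)⁻¹ := by gcongr
      _ = _ := by simp
  · have h1 : ¬ s ≤ 2 ^ i * δ := Nat.find_min hex (by lia)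
    calc δ / (δ + s) ^ (n + 1) ≤ δ / (2 ^ i * δ) ^ (n + 1) := by gcongr; linarith
      _ = 2 ^ (n + 1) * (1 / 2) ^ (i + 1) * ((2 ^ (i + 1) * δ) ^ n)⁻¹ := by
        rw [one_div_pow, mul_pow, mul_pow]; field_simp; ring

/-- A function whose normalized integrals over shrinking balls around `x` vanish in the limit is
annihilated at `x` by the Poisson approximate identity. -/
lemma tendsto_integral_poissonKernel_mul {x : EuclideanSpace ℝ (Fin n)}
    {u : EuclideanSpace ℝ (Fin n) → ℝ} (hu : Integrable u volume)
    (hx : Tendsto (fun r : ℝ => (∫ y in Metric.closedBall x r, |u y|) / r ^ n)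
      (nhdsWithin 0 (Set.Ioi 0)) (nhds 0)) :
    Tendsto (fun δ : ℝ => ∫ y, δ / (δ + ‖x - y‖) ^ (n + 1) * |u y|)
      (nhdsWithin 0 (Set.Ioi 0)) (nhds 0) := by
  set w : ℝ → ℝ := fun r => (∫ y in Metric.closedBall x r, |u y|) / r ^ n with hw
  have hint0 : ∀ r, 0 ≤ ∫ y in Metric.closedBall x r, |u y| := fun r =>
    integral_nonneg fun y => abs_nonneg _
  have hw0 : ∀ r, 0 < r → 0 ≤ w r := fun r hr => div_nonneg (hint0 r) (by positivity)
  obtain ⟨W, hW⟩ : ∃ W : ℝ, ∀ r, 0 < r → w r ≤ W := by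
    obtain ⟨r₀, hr₀, hsub⟩ := mem_nhdsGT_iff_exists_Ioo_subset.1
      (hx.eventually (gt_mem_nhds one_pos))
    refine ⟨1 + (∫ y, |u y|) / r₀ ^ n, fun r hr => ?_⟩
    have h0 : 0 ≤ ∫ y, |u y| := integral_nonneg fun y => abs_nonneg _
    have hr₀' : 0 < r₀ := hr₀
    rcases lt_or_ge r r₀ with h | h
    · have : w r < 1 := hsub ⟨hr, h⟩
      have : 0 ≤ (∫ y, |u y|) / r₀ ^ n := by positivity
      linarith
    · have : w r ≤ (∫ y, |u y|) / r₀ ^ n := by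
        refine div_le_div₀ h0 ?_ (by positivity) (by gcongr)
        exact setIntegral_le_integral hu.abs (ae_of_all _ fun y => abs_nonneg _)
      linarith
  have hgeom : Summable fun i : ℕ => 2 ^ (n + 1) * (1 / 2 : ℝ) ^ i * W :=
    (summable_geometric_two.mul_left _).mul_right _
  have hterm : ∀ δ : ℝ, 0 < δ → ∀ i : ℕ,
      2 ^ (n + 1) * (1 / 2 : ℝ) ^ i * w (2 ^ i * δ) ≤ 2 ^ (n + 1) * (1 / 2 : ℝ) ^ i * W :=
    fun δ hδ i => by gcongr; exact hW _ (by positivity)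
  have hterm0 : ∀ δ : ℝ, 0 < δ → ∀ i : ℕ,
      0 ≤ 2 ^ (n + 1) * (1 / 2 : ℝ) ^ i * w (2 ^ i * δ) := fun δ hδ i =>
    mul_nonneg (by positivity) (hw0 _ (by positivity))
  have hlim : Tendsto (fun δ : ℝ => ∑' i : ℕ, 2 ^ (n + 1) * (1 / 2 : ℝ) ^ i * w (2 ^ i * δ))
      (nhdsWithin 0 (Set.Ioi 0)) (nhds 0) := by
    have h := tendsto_tsum_of_dominated_convergence (𝓕 := nhdsWithin (0 : ℝ) (Set.Ioi 0))
      (f := fun δ (i : ℕ) => 2 ^ (n + 1) * (1 / 2 : ℝ) ^ i * w (2 ^ i * δ)) (g := fun _ => 0)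
      hgeom (fun i => ?_) ?_
    · simpa using h
    · have h1 : Tendsto (fun δ : ℝ => 2 ^ i * δ) (nhdsWithin 0 (Set.Ioi 0))
          (nhdsWithin 0 (Set.Ioi 0)) := by
        refine tendsto_nhdsWithin_iff.2 ⟨?_, ?_⟩
        · have : Tendsto (fun δ : ℝ => 2 ^ i * δ) (nhds 0) (nhds (2 ^ i * 0)) :=
            tendsto_id.const_mul _
          rw [mul_zero] at this
          exact this.mono_left nhdsWithin_le_nhds
        · filter_upwards [self_mem_nhdsWithin] with δ hδ
          have : (0 : ℝ) < δ := hδ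
          exact Set.mem_Ioi.2 (by positivity)
      simpa using (hx.comp h1).const_mul (2 ^ (n + 1) * (1 / 2 : ℝ) ^ i)
    · filter_upwards [self_mem_nhdsWithin] with δ hδ i
      rw [Real.norm_of_nonneg (hterm0 δ hδ i)]
      exact hterm δ hδ i
  refine squeeze_zero' ?_ ?_ hlim
  · filter_upwards [self_mem_nhdsWithin] with δ hδ
    have : (0 : ℝ) < δ := hδ
    exact integral_nonneg fun y => by positivity
  · filter_upwards [self_mem_nhdsWithin] with δ hδ
    have hδ' : (0 : ℝ) < δ := hδ
    have hsum : Summable fun i : ℕ => 2 ^ (n + 1) * (1 / 2 : ℝ) ^ i * w (2 ^ i * δ) :=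
      hgeom.of_nonneg_of_le (hterm0 δ hδ') (hterm δ hδ')
    have hnn : ∀ y, 0 ≤ δ / (δ + ‖x - y‖) ^ (n + 1) * |u y| := fun y => by positivity
    let a : ℕ → ℝ := fun i => 2 ^ (n + 1) * (1 / 2 : ℝ) ^ i * ((2 ^ i * δ) ^ n)⁻¹
    have ha : ∀ i, 0 ≤ a i := fun i => by positivity
    have hmeas : ∀ i : ℕ, AEMeasurable (fun y =>
        (Metric.closedBall x (2 ^ i * δ)).indicator
          (fun y => ENNReal.ofReal (a i * |u y|)) y) volume := fun i =>
      ((hu.abs.aestronglyMeasurable.aemeasurable.const_mul _).ennreal_ofReal).indicator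
        Metric.isClosed_closedBall.measurableSet
    have hcell : ∀ i : ℕ, ∫⁻ y, (Metric.closedBall x (2 ^ i * δ)).indicator
        (fun y => ENNReal.ofReal (a i * |u y|)) y =
        ENNReal.ofReal (2 ^ (n + 1) * (1 / 2 : ℝ) ^ i * w (2 ^ i * δ)) := fun i => by
      rw [lintegral_indicator Metric.isClosed_closedBall.measurableSet,
        ← ofReal_integral_eq_lintegral_ofReal (hu.abs.const_mul _).integrableOn
          (ae_of_all _ fun y => mul_nonneg (ha i) (abs_nonneg _)), integral_const_mul]
      simp only [a, hw, div_eq_mul_inv]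
      congr 1
      ring
    have hF : AEStronglyMeasurable (fun y => δ / (δ + ‖x - y‖) ^ (n + 1) * |u y|) volume :=
      (by fun_prop : Measurable fun y => δ / (δ + ‖x - y‖) ^ (n + 1)).aestronglyMeasurable.mul
        hu.abs.aestronglyMeasurable
    rw [integral_eq_lintegral_of_nonneg_ae (ae_of_all _ hnn) hF]
    refine ENNReal.toReal_le_of_le_ofReal (tsum_nonneg (hterm0 δ hδ')) ?_
    rw [ENNReal.ofReal_tsum_of_nonneg (hterm0 δ hδ') hsum]
    simp only [← hcell]
    rw [← lintegral_tsum hmeas]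
    refine lintegral_mono fun y => ?_
    obtain ⟨i, hi, hle⟩ := exists_poissonKernel_le_dyadic n hδ' (norm_nonneg (x - y))
    refine le_trans ?_ (ENNReal.le_tsum i)
    rw [Set.indicator_of_mem (by rwa [Metric.mem_closedBall, dist_comm, dist_eq_norm])]
    exact ENNReal.ofReal_le_ofReal
      (mul_le_mul_of_nonneg_right hle (abs_nonneg _))

lemma ae_tendsto_setIntegral_closedBall_div_pow {f : EuclideanSpace ℝ (Fin n) → ℝ}
    (hf : Integrable f volume) :
    ∀ᵐ x ∂(volume : Measure (EuclideanSpace ℝ (Fin n))),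
      Tendsto (fun r : ℝ => (∫ y in Metric.closedBall x r,
        |f y - (Metric.closedBall x 1).indicator (fun _ => f x) y|) / r ^ n)
      (nhdsWithin 0 (Set.Ioi 0)) (nhds 0) := by
  filter_upwards [IsUnifLocDoublingMeasure.ae_tendsto_average_norm_sub volume
    hf.locallyIntegrable 1] with x hx
  have h := hx (l := nhdsWithin (0 : ℝ) (Set.Ioi 0)) (fun _ => x) id tendsto_id (by
    filter_upwards [self_mem_nhdsWithin] with r hr
    have : (0 : ℝ) < r := hr
    simpa using this.le)
  have h' := h.const_mul (volume.real (Metric.ball (0 : EuclideanSpace ℝ (Fin n)) 1))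
  rw [mul_zero] at h'
  refine h'.congr' ?_
  filter_upwards [Ioo_mem_nhdsGT (one_pos : (0 : ℝ) < 1)] with r hr
  have hV : 0 < volume.real (Metric.ball (0 : EuclideanSpace ℝ (Fin n)) 1) :=
    ENNReal.toReal_pos (Metric.measure_ball_pos _ _ one_pos).ne' measure_ball_lt_top.ne
  have hr0 : 0 < r := hr.1
  have hvol : volume.real (Metric.closedBall x r) =
      r ^ n * volume.real (Metric.ball (0 : EuclideanSpace ℝ (Fin n)) 1) := by
    rw [measureReal_def, Measure.addHaar_closedBall _ _ hr0.le, ENNReal.toReal_mul,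
      ENNReal.toReal_ofReal (by positivity), finrank_euclideanSpace_fin, measureReal_def]
  have hcongr : ∫ y in Metric.closedBall x r,
      |f y - (Metric.closedBall x 1).indicator (fun _ => f x) y| =
      ∫ y in Metric.closedBall x r, ‖f y - f x‖ := by
    refine setIntegral_congr_fun Metric.isClosed_closedBall.measurableSet fun y hy => ?_
    rw [Set.indicator_of_mem (Metric.closedBall_subset_closedBall hr.2.le hy), Real.norm_eq_abs]
  rw [setAverage_eq, hcongr, id, hvol, smul_eq_mul]
  field_simp

lemma volume_setOf_apply_eq (i : Fin n) (a : ℝ) :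
    volume {y : EuclideanSpace ℝ (Fin n) | y i = a} = 0 := by
  have h := (EuclideanSpace.volume_preserving_symm_measurableEquiv_toLp (Fin n)).measure_preimage
    (s := {y : Fin n → ℝ | y i = a})
    (measurableSet_eq_fun (measurable_pi_apply i) measurable_const).nullMeasurableSet
  rw [volume_pi, Measure.pi_hyperplane] at h
  exact h

lemma gridProj_reflect_ae (hδ : 0 < δ) (k : Fin n → ℤ) :
    ∀ᵐ y ∂(volume : Measure (EuclideanSpace ℝ (Fin n))),
      gridProj δ (gridPoint δ k + gridPoint δ k - y) =
        gridPoint δ k + gridPoint δ k - gridProj δ y := by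
  have hne : ∀ᵐ y ∂(volume : Measure (EuclideanSpace ℝ (Fin n))),
      ∀ (i : Fin n) (m : ℤ), y i ≠ δ * (m - 1 / 2) :=
    ae_all_iff.2 fun i => ae_all_iff.2 fun m => by
      rw [ae_iff]
      simpa using volume_setOf_apply_eq i (δ * (m - 1 / 2))
  filter_upwards [hne] with y hy
  ext i
  have h1 : (δ * k i + δ * k i - y i) / δ = ((2 * k i : ℤ) : ℝ) - y i / δ := by
    push_cast
    field_simp
    ring
  have h2 := round_eq_iff.1 (rfl : round (y i / δ) = round (y i / δ))
  have h3 : (round (y i / δ) : ℝ) - 1 / 2 ≠ y i / δ := fun h => hy i _ (by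
    rw [h]; field_simp)
  have h4 : round (((2 * k i : ℤ) : ℝ) - y i / δ) = 2 * k i - round (y i / δ) := by
    rw [round_eq_iff]
    push_cast
    constructor <;> linarith [h2.1.lt_of_ne h3, h2.2]
  simp only [gridProj, gridPoint_apply, gridIndex, PiLp.sub_apply, PiLp.add_apply]
  rw [h1, h4]
  push_cast
  ring

lemma setIntegral_closedBall_symmKernel_eq_zero (hδ : 0 < δ) (x : EuclideanSpace ℝ (Fin n)) :
    ∫ y in Metric.closedBall (gridProj δ x) 1, symmKernel j δ x y = 0 := by
  set q := gridProj δ x with hq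
  let F : EuclideanSpace ℝ (Fin n) → ℝ := (Metric.closedBall q 1).indicator (symmKernel j δ x)
  have hodd : ∀ᵐ y ∂(volume : Measure (EuclideanSpace ℝ (Fin n))), F (q + q - y) = -F y := by
    filter_upwards [gridProj_reflect_ae hδ (gridIndex δ x)] with y hy
    have hmem : q + q - y ∈ Metric.closedBall q 1 ↔ y ∈ Metric.closedBall q 1 := by
      rw [mem_closedBall_iff_norm, mem_closedBall_iff_norm', add_sub_assoc, add_sub_cancel_left]
    by_cases hmy : y ∈ Metric.closedBall q 1
    · simp only [F, Set.indicator_of_mem hmy, Set.indicator_of_mem (hmem.2 hmy), symmKernel]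
      have hp : gridProj δ (q + q - y) = q + q - gridProj δ y := hy
      have e1 : x - (q + q - gridProj δ y) = -(gridReflect δ x - gridProj δ y) := by
        rw [gridReflect, ← hq]; abel
      have e2 : gridReflect δ x - (q + q - gridProj δ y) = -(x - gridProj δ y) := by
        rw [gridReflect, ← hq]; abel
      rw [hp, e1, e2, rieszKernel_neg, rieszKernel_neg]
      ring
    · simp only [F, Set.indicator_of_notMem hmy, Set.indicator_of_notMem (mt hmem.1 hmy), neg_zero]
  have h1 : ∫ y, F (q + q - y) = ∫ y, F y := integral_sub_left_eq_self F volume (q + q)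
  rw [integral_congr_ae hodd, integral_neg] at h1
  rw [← integral_indicator Metric.isClosed_closedBall.measurableSet]
  change ∫ y, F y = 0
  linarith

lemma setIntegral_closedBall_truncKernel_eq_zero (x : EuclideanSpace ℝ (Fin n)) :
    ∫ y in Metric.closedBall x 1, truncKernel n j δ (x - y) = 0 := by
  let F : EuclideanSpace ℝ (Fin n) → ℝ :=
    (Metric.closedBall x 1).indicator fun y => truncKernel n j δ (x - y)
  have hodd : ∀ y, F (x + x - y) = -F y := by
    intro y
    have hmem : x + x - y ∈ Metric.closedBall x 1 ↔ y ∈ Metric.closedBall x 1 := by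
      rw [mem_closedBall_iff_norm, mem_closedBall_iff_norm', add_sub_assoc, add_sub_cancel_left]
    by_cases hmy : y ∈ Metric.closedBall x 1
    · simp only [F, Set.indicator_of_mem hmy, Set.indicator_of_mem (hmem.2 hmy)]
      rw [← truncKernel_neg]
      congr 1
      abel
    · simp only [F, Set.indicator_of_notMem hmy, Set.indicator_of_notMem (mt hmem.1 hmy), neg_zero]
  have h1 : ∫ y, F (x + x - y) = ∫ y, F y := integral_sub_left_eq_self F volume (x + x)
  simp only [hodd, integral_neg] at h1
  rw [← integral_indicator Metric.isClosed_closedBall.measurableSet]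
  change ∫ y, F y = 0
  linarith

lemma integrable_symmKernel_mul (hδ : 0 < δ) {f : EuclideanSpace ℝ (Fin n) → ℝ}
    (hf : Integrable f volume) (x : EuclideanSpace ℝ (Fin n)) :
    Integrable (fun y => symmKernel j δ x y * f y) volume :=
  hf.bdd_mul (measurable_symmKernel x).aestronglyMeasurable
    (ae_of_all _ fun y => abs_symmKernel_le hδ x y)

lemma integrable_truncKernel_mul (hδ : 0 < δ) {f : EuclideanSpace ℝ (Fin n) → ℝ}
    (hf : Integrable f volume) (x : EuclideanSpace ℝ (Fin n)) :
    Integrable (fun y => truncKernel n j δ (x - y) * f y) volume :=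
  hf.bdd_mul (measurable_truncKernel.comp (measurable_id.const_sub x)).aestronglyMeasurable
    (ae_of_all _ fun y => abs_truncKernel_le hδ (x - y))

lemma integrable_indicator_closedBall (x : EuclideanSpace ℝ (Fin n)) (r c : ℝ) :
    Integrable ((Metric.closedBall x r).indicator fun _ => c) volume :=
  (integrable_indicator_iff Metric.isClosed_closedBall.measurableSet).2
    (integrableOn_const measure_closedBall_lt_top.ne)

lemma abs_symmKernel_le_of_far (hδ : 0 < δ) {x y : EuclideanSpace ℝ (Fin n)} {r : ℝ} (hr : 0 < r)
    (h : r + 3 * n * δ ≤ ‖x - y‖) : |symmKernel j δ x y| ≤ 2 * (rieszConst n / r ^ n) := by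
  have h1 := norm_sub_norm_le (x - y) (x - gridProj δ y)
  have h2 := norm_sub_norm_le (x - y) (gridReflect δ x - gridProj δ y)
  rw [norm_sub_rev (x - y)] at h1 h2
  have h3 := norm_sub_gridProj_sub_le hδ x y
  have h4 := norm_gridReflect_sub_gridProj_sub_le hδ x y
  rw [two_mul]
  exact (abs_add_le _ _).trans (add_le_add (abs_rieszKernel_le hr (by linarith))
    (abs_rieszKernel_le hr (by linarith)))

lemma tendsto_setIntegral_closedBall_symmKernel (x : EuclideanSpace ℝ (Fin n)) :
    Tendsto (fun δ : ℝ => ∫ y in Metric.closedBall x 1, symmKernel j δ x y)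
      (nhdsWithin 0 (Set.Ioi 0)) (nhds 0) := by
  let F : ℝ → EuclideanSpace ℝ (Fin n) → ℝ := fun δ y =>
    symmKernel j δ x y * (Metric.closedBall x 1).indicator (fun _ => (1 : ℝ)) y -
      symmKernel j δ x y * (Metric.closedBall (gridProj δ x) 1).indicator (fun _ => (1 : ℝ)) y
  have hset : ∀ (δ : ℝ) (z : EuclideanSpace ℝ (Fin n)),
      ∫ y in Metric.closedBall z 1, symmKernel j δ x y =
      ∫ y, symmKernel j δ x y * (Metric.closedBall z 1).indicator (fun _ => (1 : ℝ)) y := by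
    intro δ z
    rw [← integral_indicator Metric.isClosed_closedBall.measurableSet]
    congr 1
    funext y
    by_cases hy : y ∈ Metric.closedBall z 1 <;> simp [Set.indicator, hy]
  have hF : ∀ δ : ℝ, 0 < δ → ∫ y, F δ y = ∫ y in Metric.closedBall x 1, symmKernel j δ x y := by
    intro δ hδ
    have h0 := setIntegral_closedBall_symmKernel_eq_zero (j := j) hδ x
    rw [hset] at h0 ⊢
    rw [integral_sub (integrable_symmKernel_mul hδ (integrable_indicator_closedBall _ _ _) x)
      (integrable_symmKernel_mul hδ (integrable_indicator_closedBall _ _ _) x), h0, sub_zero]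
  have hball : ∀ {δ : ℝ}, 0 < δ → ∀ y, |‖y - gridProj δ x‖ - ‖y - x‖| ≤ n * δ := by
    intro δ hδ y
    refine (abs_norm_sub_norm_le _ _).trans ?_
    rw [sub_sub_sub_cancel_left]
    exact norm_sub_gridProj_le hδ x
  have hFzero : ∀ δ : ℝ, 0 < δ → ∀ y, n * δ < |‖y - x‖ - 1| → F δ y = 0 := by
    intro δ hδ y hy
    have hb := abs_le.1 (hball hδ y)
    have hmem : y ∈ Metric.closedBall x 1 ↔ y ∈ Metric.closedBall (gridProj δ x) 1 := by
      rw [mem_closedBall_iff_norm, mem_closedBall_iff_norm]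
      rcases lt_abs.1 hy with h | h
      · constructor <;> intro h' <;> linarith
      · have : 0 ≤ n * δ := by positivity
        constructor <;> intro h' <;> linarith
    by_cases h : y ∈ Metric.closedBall x 1
    · simp only [F, Set.indicator_of_mem h, Set.indicator_of_mem (hmem.1 h), sub_self]
    · simp only [F, Set.indicator_of_notMem h, Set.indicator_of_notMem (mt hmem.2 h), sub_self]
  have hsmall : ∀ᶠ δ : ℝ in nhdsWithin 0 (Set.Ioi 0), 0 < δ ∧ 4 * n * δ < 1 / 2 := by
    have hcont : Tendsto (fun δ : ℝ => 4 * n * δ) (nhds 0) (nhds (4 * n * 0)) :=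
      tendsto_id.const_mul _
    rw [mul_zero] at hcont
    filter_upwards [self_mem_nhdsWithin, nhdsWithin_le_nhds
      (hcont.eventually (gt_mem_nhds one_half_pos))] with δ h1 h2 using ⟨h1, h2⟩
  have hlim : Tendsto (fun δ : ℝ => ∫ y, F δ y) (nhdsWithin 0 (Set.Ioi 0))
      (nhds (∫ _y : EuclideanSpace ℝ (Fin n), (0 : ℝ))) := by
    refine tendsto_integral_filter_of_dominated_convergence
      ((Metric.closedBall x 2).indicator fun _ => 2 * (rieszConst n / (1 / 2) ^ n)) ?_ ?_
      (integrable_indicator_closedBall _ _ _) ?_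
    · filter_upwards [hsmall] with δ hδ
      exact ((integrable_symmKernel_mul hδ.1 (integrable_indicator_closedBall _ _ _) x).sub
        (integrable_symmKernel_mul hδ.1
          (integrable_indicator_closedBall _ _ _) x)).aestronglyMeasurable
    · filter_upwards [hsmall] with δ hδ
      refine ae_of_all _ fun y => ?_
      have hc := (rieszConst_pos n).le
      have hn : 0 ≤ n * δ := mul_nonneg (Nat.cast_nonneg n) hδ.1.le
      by_cases hy : n * δ < |‖y - x‖ - 1|
      · rw [hFzero δ hδ.1 y hy, norm_zero]
        exact Set.indicator_nonneg (fun _ _ => by positivity) y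
      · have h1 := abs_le.1 (not_lt.1 hy)
        have hk := abs_symmKernel_le_of_far (j := j) hδ.1 (x := x) (y := y)
          (r := 1 / 2) (by norm_num) (by rw [norm_sub_rev]; linarith)
        rw [Set.indicator_of_mem (by rw [mem_closedBall_iff_norm]; linarith)]
        refine le_trans ?_ hk
        simp only [F, ← mul_sub]
        rw [norm_mul, Real.norm_eq_abs]
        refine mul_le_of_le_one_right (abs_nonneg _) ?_
        simp only [Set.indicator]
        split_ifs <;> norm_num
    · have hsph : ∀ᵐ y ∂(volume : Measure (EuclideanSpace ℝ (Fin n))), ‖y - x‖ ≠ 1 := by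
        have h := Measure.addHaar_sphere_of_ne_zero
          (volume : Measure (EuclideanSpace ℝ (Fin n))) x one_ne_zero
        rw [ae_iff]
        simp only [ne_eq, not_not]
        exact measure_mono_null (fun y hy => mem_sphere_iff_norm.2 hy) h
      filter_upwards [hsph] with y hy
      have hpos : 0 < |‖y - x‖ - 1| := abs_pos.2 (sub_ne_zero.2 hy)
      have hcont : Tendsto (fun δ : ℝ => n * δ) (nhds 0) (nhds (n * 0)) :=
        tendsto_id.const_mul _
      rw [mul_zero] at hcont
      refine tendsto_const_nhds.congr' ?_
      filter_upwards [self_mem_nhdsWithin, nhdsWithin_le_nhds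
        (hcont.eventually (gt_mem_nhds hpos))] with δ h1 h2 using (hFzero δ h1 y h2).symm
  rw [integral_zero] at hlim
  refine hlim.congr' ?_
  filter_upwards [self_mem_nhdsWithin] with δ hδ using hF δ hδ

lemma gridRiesz_add_reflect_eq (hδ : 0 < δ) {f : EuclideanSpace ℝ (Fin n) → ℝ}
    (hf : Integrable f volume) (x : EuclideanSpace ℝ (Fin n)) :
    gridRiesz j δ f x + gridRiesz j δ f (gridReflect δ x) = ∫ y, symmKernel j δ x y * f y := by
  rw [gridRiesz, gridRiesz, ← integral_add (integrable_rieszKernel_sub_gridProj_mul hδ hf _)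
    (integrable_rieszKernel_sub_gridProj_mul hδ hf _)]
  simp only [symmKernel, add_mul]

lemma tendsto_gridRiesz_add_reflect {f : EuclideanSpace ℝ (Fin n) → ℝ}
    (hf : Integrable f volume) {x : EuclideanSpace ℝ (Fin n)} {g : ℝ}
    (hleb : Tendsto (fun r : ℝ => (∫ y in Metric.closedBall x r,
        |f y - (Metric.closedBall x 1).indicator (fun _ => f x) y|) / r ^ n)
      (nhdsWithin 0 (Set.Ioi 0)) (nhds 0))
    (hg : Tendsto (fun δ : ℝ => ∫ y, truncKernel n j δ (x - y) * f y)
      (nhdsWithin 0 (Set.Ioi 0)) (nhds g)) :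
    Tendsto (fun δ : ℝ => gridRiesz j δ f x + gridRiesz j δ f (gridReflect δ x))
      (nhdsWithin 0 (Set.Ioi 0)) (nhds (2 * g)) := by
  obtain ⟨C, hC, hker⟩ := exists_abs_symmKernel_sub_truncKernel_le n j
  set b : EuclideanSpace ℝ (Fin n) → ℝ := (Metric.closedBall x 1).indicator fun _ => f x with hb
  have hbint : Integrable b volume := integrable_indicator_closedBall _ _ _
  have hu : Integrable (fun y => f y - b y) volume := hf.sub hbint
  have hset : ∀ K : EuclideanSpace ℝ (Fin n) → ℝ,
      ∫ y, K y * b y = f x * ∫ y in Metric.closedBall x 1, K y := by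
    intro K
    rw [← integral_const_mul, ← integral_indicator Metric.isClosed_closedBall.measurableSet]
    congr 1
    funext y
    by_cases hy : y ∈ Metric.closedBall x 1 <;> simp [hb, Set.indicator, hy, mul_comm]
  have herr : Tendsto (fun δ : ℝ =>
      ∫ y, (symmKernel j δ x y - 2 * truncKernel n j δ (x - y)) * (f y - b y))
      (nhdsWithin 0 (Set.Ioi 0)) (nhds 0) := by
    have hP := (tendsto_integral_poissonKernel_mul hu hleb).const_mul C
    rw [mul_zero] at hP
    refine squeeze_zero_norm' ?_ hP
    filter_upwards [self_mem_nhdsWithin] with δ hδ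
    have hδ' : 0 < δ := hδ
    rw [← integral_const_mul]
    refine norm_integral_le_of_norm_le ?_ (ae_of_all _ fun y => ?_)
    · refine (hu.abs.bdd_mul (c := δ / δ ^ (n + 1))
        (by fun_prop : Measurable fun y => δ / (δ + ‖x - y‖) ^ (n + 1)).aestronglyMeasurable
        (ae_of_all _ fun y => ?_)).const_mul C
      rw [Real.norm_of_nonneg (by positivity)]
      gcongr
      linarith [norm_nonneg (x - y)]
    · rw [norm_mul, Real.norm_eq_abs, Real.norm_eq_abs, ← mul_assoc]
      exact mul_le_mul_of_nonneg_right (hker δ hδ' x y) (abs_nonneg _)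
  have hsum := ((hg.const_mul 2).add herr).add
    ((tendsto_setIntegral_closedBall_symmKernel (j := j) x).const_mul (f x))
  simp only [add_zero, mul_zero] at hsum
  refine hsum.congr' ?_
  filter_upwards [self_mem_nhdsWithin] with δ hδ
  have hδ' : 0 < δ := hδ
  have hs := integrable_symmKernel_mul (j := j) hδ' hf x
  have ht := integrable_truncKernel_mul (j := j) hδ' hf x
  have hsb := integrable_symmKernel_mul (j := j) hδ' hbint x
  have htb := integrable_truncKernel_mul (j := j) hδ' hbint x
  have hexp : ∀ y, (symmKernel j δ x y - 2 * truncKernel n j δ (x - y)) * (f y - b y) =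
      (symmKernel j δ x y * f y - 2 * (truncKernel n j δ (x - y) * f y)) -
        (symmKernel j δ x y * b y - 2 * (truncKernel n j δ (x - y) * b y)) := fun y => by ring
  have h1 : Integrable (fun y =>
      symmKernel j δ x y * f y - 2 * (truncKernel n j δ (x - y) * f y)) volume :=
    hs.sub (ht.const_mul 2)
  have h2 : Integrable (fun y =>
      symmKernel j δ x y * b y - 2 * (truncKernel n j δ (x - y) * b y)) volume :=
    hsb.sub (htb.const_mul 2)
  rw [gridRiesz_add_reflect_eq hδ' hf, integral_congr_ae (ae_of_all _ hexp), integral_sub h1 h2,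
    integral_sub hs (ht.const_mul 2), integral_sub hsb (htb.const_mul 2), integral_const_mul,
    integral_const_mul, hset, hset, setIntegral_closedBall_truncKernel_eq_zero]
  ring

end RieszReduction

/-- Reduction of the weak-type (1,1) inequality for the Riesz transforms to
finite nonnegative linear combinations of Dirac masses, with an absolute
(dimension-free) constant. -/
theorem riesz_weak_type_reduction_to_diracs :
    ∃ C : ℝ, 0 < C ∧
      ∀ (n : ℕ), 1 ≤ n → ∀ (j : Fin n), ∀ lam : ℝ, 0 < lam →
        ∀ f : EuclideanSpace ℝ (Fin n) → ℝ, Integrable f volume →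
        ∀ g : EuclideanSpace ℝ (Fin n) → ℝ, Measurable g →
        (∀ᵐ x ∂(volume : Measure (EuclideanSpace ℝ (Fin n))),
          Tendsto (fun ε : ℝ =>
              ∫ y in {y : EuclideanSpace ℝ (Fin n) | ε ≤ ‖x - y‖},
                rieszConst n * (x j - y j) / ‖x - y‖ ^ (n + 1) * f y)
            (nhdsWithin 0 (Set.Ioi 0)) (nhds (g x))) →
        volume {x : EuclideanSpace ℝ (Fin n) | lam < |g x|} ≤
          ENNReal.ofReal C *
            (ENNReal.ofReal ((1 / lam) * ∫ x, |f x|) +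
              ⨆ (N : ℕ) (c : Fin N → EuclideanSpace ℝ (Fin n)) (a : Fin N → ℝ)
                (_ : ∀ k, 0 < a k) (_ : ∑ k, a k ≤ 16 * ∫ x, |f x|),
                volume {x : EuclideanSpace ℝ (Fin n) | lam < |rieszDirac n j c a x|}) := by
  refine ⟨4, by norm_num, fun n _ j lam _ f hf g _ hg => ?_⟩
  set B := ⨆ (N : ℕ) (c : Fin N → EuclideanSpace ℝ (Fin n)) (a : Fin N → ℝ)
    (_ : ∀ k, 0 < a k) (_ : ∑ k, a k ≤ 16 * ∫ x, |f x|),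
    volume {x : EuclideanSpace ℝ (Fin n) | lam < |rieszDirac n j c a x|}
  have hB : ∀ (N : ℕ) (c : Fin N → EuclideanSpace ℝ (Fin n)) (a : Fin N → ℝ), (∀ k, 0 < a k) →
      ∑ k, a k ≤ 16 * ∫ x, |f x| → volume {x | lam < |rieszDirac n j c a x|} ≤ B :=
    fun N c a ha hsum => le_iSup_of_le N <| le_iSup_of_le c <| le_iSup_of_le a <|
      le_iSup_of_le ha <| le_iSup_of_le hsum le_rfl
  have hmass : 2 * ∫ x, |f x| ≤ 16 * ∫ x, |f x| := by
    have : 0 ≤ ∫ x, |f x| := integral_nonneg fun x => abs_nonneg _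
    linarith
  let δ : ℕ → ℝ := fun m => 1 / ((m : ℝ) + 1)
  have hδ : ∀ m, 0 < δ m := fun m => by positivity
  have hδlim : Tendsto δ atTop (nhdsWithin 0 (Set.Ioi 0)) :=
    tendsto_nhdsWithin_iff.2 ⟨tendsto_one_div_add_atTop_nhds_zero_nat, Eventually.of_forall hδ⟩
  have hlim : ∀ᵐ x ∂(volume : Measure (EuclideanSpace ℝ (Fin n))), Tendsto (fun m =>
      RieszReduction.gridRiesz j (δ m) f x +
        RieszReduction.gridRiesz j (δ m) f (RieszReduction.gridReflect (δ m) x))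
      atTop (nhds (2 * g x)) := by
    filter_upwards [hg, RieszReduction.ae_tendsto_setIntegral_closedBall_div_pow hf]
      with x hgx hleb
    refine (RieszReduction.tendsto_gridRiesz_add_reflect hf hleb (hgx.congr fun ε => ?_)).comp hδlim
    have hmeas : MeasurableSet {y : EuclideanSpace ℝ (Fin n) | ε ≤ ‖x - y‖} :=
      measurableSet_le measurable_const (by fun_prop)
    rw [← integral_indicator hmeas]
    congr 1
    funext y
    by_cases hy : ε ≤ ‖x - y‖ <;>
      simp [RieszReduction.truncKernel, RieszReduction.rieszKernel, Set.indicator, hy]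
  have hmain := RieszReduction.measure_lt_abs_le_of_tendsto hlim
    fun m => RieszReduction.volume_gridRiesz_add_reflect_le hB (hδ m) hf hmass
  have hset : {x | lam < |g x|} = {x | 2 * lam < |2 * g x|} := by
    ext x
    simp [abs_mul]
  rw [hset, show ENNReal.ofReal 4 = 4 by norm_num]
  exact hmain.trans (by gcongr; exact le_add_self)
end

section
/- There exists an absolute constant C > 0 such that for every n ≥ 2, every j ∈ {1,…,n}, every λ > 0, every N ∈ ℕ, all points c_1,…,c_N ∈ ℝⁿ, and all a_1,…,a_N > 0, one has λ · |{x ∈ ℝⁿ : |R_jν(x)| > λ}| ≤ C log(n) · Σ_{k=1}^N a_k, where ν = Σ_{k=1}^N a_k δ_{c_k}. -/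
open MeasureTheory Set

/-- Shrinking towards `p` preserves the comparison of the distance to `p` with that to `q`. -/
theorem norm_shrink_sub_le {E : Type*} [NormedAddCommGroup E] [NormedSpace ℝ E] {p q x : E}
    {s : ℝ} (hs : 1 ≤ s) :
    ‖s⁻¹ • (x - p)‖ - ‖x - p‖ ≤ ‖p + s⁻¹ • (x - p) - q‖ - ‖x - q‖ := by
  have hs0 : 0 < s := by linarith
  have h1 : x - q = (p + s⁻¹ • (x - p) - q) + (1 - s⁻¹) • (x - p) := by
    rw [sub_smul, one_smul]; abel
  have h2 : ‖x - q‖ ≤ ‖p + s⁻¹ • (x - p) - q‖ + (1 - s⁻¹) * ‖x - p‖ := by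
    conv_lhs => rw [h1]
    refine (norm_add_le _ _).trans ?_
    rw [norm_smul, Real.norm_of_nonneg (sub_nonneg.2 (inv_le_one_of_one_le₀ hs))]
  rw [norm_smul, Real.norm_of_nonneg (by positivity)]
  linarith

section Geometry

variable {E : Type*} [NormedAddCommGroup E] [NormedSpace ℝ E] [FiniteDimensional ℝ E]
  [MeasurableSpace E] [BorelSpace E] (μ : Measure E) [μ.IsAddHaarMeasure]

/-- Outside a set of finite measure, balls with a given centre attain every measure. -/
theorem exists_radius_measure_ball_diff_eq [Nontrivial E] (c : E) {F : Set E}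
    (hF : μ F ≠ ⊤) {t : ℝ} (ht : 0 < t) :
    ∃ r : ℝ, 0 < r ∧ μ (Metric.ball c r \ F) = ENNReal.ofReal t := by
  set d := Module.finrank ℝ E
  have hd : d ≠ 0 := Module.finrank_pos.ne'
  set v := μ.real (Metric.ball (0 : E) 1)
  have hv : 0 < v := ENNReal.toReal_pos (Metric.measure_ball_pos μ 0 one_pos).ne'
    measure_ball_lt_top.ne
  have hball : ∀ r : ℝ, 0 ≤ r → μ.real (Metric.ball c r) = r ^ d * v := fun r hr =>
    measureReal_def μ _ ▸ by
      rw [Measure.addHaar_ball μ c hr, ENNReal.toReal_mul, ENNReal.toReal_ofReal (by positivity)]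
      rfl
  set g : ℝ → ℝ := fun r => μ.real (Metric.ball c r \ F)
  have hfin : ∀ r, μ (Metric.ball c r) ≠ ⊤ := fun r => measure_ball_lt_top.ne
  have hmono : ∀ r s, 0 ≤ r → r ≤ s → g r ≤ g s ∧ g s - g r ≤ s ^ d * v - r ^ d * v := by
    intro r s hr hrs
    refine ⟨measureReal_mono (sdiff_subset_sdiff_left (Metric.ball_subset_ball hrs))
      (measure_ne_top_of_subset sdiff_subset (hfin s)), ?_⟩
    have h1 : Metric.ball c s \ F ⊆
        (Metric.ball c r \ F) ∪ (Metric.ball c s \ Metric.ball c r) := by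
      intro x hx
      by_cases hxr : x ∈ Metric.ball c r
      · exact Or.inl ⟨hxr, hx.2⟩
      · exact Or.inr ⟨hx.1, hxr⟩
    have h2 : g s ≤ g r + μ.real (Metric.ball c s \ Metric.ball c r) :=
      (measureReal_mono h1 (measure_union_ne_top
        (measure_ne_top_of_subset sdiff_subset (hfin r))
        (measure_ne_top_of_subset sdiff_subset (hfin s)))).trans (measureReal_union_le _ _)
    have h3 := measureReal_sdiff (μ := μ) (Metric.ball_subset_ball (x := c) hrs) measurableSet_ball
      (hfin s)
    rw [h3, hball r hr, hball s (hr.trans hrs)] at h2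
    linarith
  have hcont : ContinuousOn g (Ici 0) := by
    intro a ha
    rw [ContinuousWithinAt, tendsto_iff_dist_tendsto_zero]
    have hc : Filter.Tendsto (fun r : ℝ => |r ^ d * v - a ^ d * v|) (nhdsWithin a (Ici 0))
        (nhds 0) := by
      have : Continuous fun r : ℝ => |r ^ d * v - a ^ d * v| := by fun_prop
      have h := (this.tendsto a).mono_left (nhdsWithin_le_nhds (s := Ici 0))
      simpa using h
    refine squeeze_zero' (Filter.Eventually.of_forall fun _ => dist_nonneg) ?_ hc
    filter_upwards [self_mem_nhdsWithin] with r hr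
    rw [Real.dist_eq]
    rcases le_total r a with h | h
    · obtain ⟨h1, h2⟩ := hmono r a hr h
      rw [abs_sub_comm, abs_of_nonneg (by linarith), abs_sub_comm, abs_of_nonneg (by linarith)]
      exact h2
    · obtain ⟨h1, h2⟩ := hmono a r ha h
      rw [abs_of_nonneg (by linarith), abs_of_nonneg (by linarith)]
      exact h2
  set R := (t + μ.real F) / v + 1
  have hR1 : 1 ≤ R := by
    have : 0 ≤ (t + μ.real F) / v := by positivity
    linarith
  have hgR : t ≤ g R := by
    have h1 : μ.real (Metric.ball c R) ≤ g R + μ.real F :=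
      (measureReal_mono (by intro x hx; by_cases h : x ∈ F; exacts [Or.inr h, Or.inl ⟨hx, h⟩])
        (measure_union_ne_top (measure_ne_top_of_subset sdiff_subset (hfin R)) hF)).trans
        (measureReal_union_le _ _)
    rw [hball R (by linarith)] at h1
    have h2 : R ≤ R ^ d := le_self_pow₀ hR1 hd
    have h3 : R * v ≤ R ^ d * v := by gcongr
    have h4 : R * v = t + μ.real F + v := by
      simp only [R]; field_simp
    linarith
  have hg0 : g 0 = 0 := by simp [g]
  obtain ⟨r, hr, hgr⟩ := intermediate_value_Icc (by linarith : (0 : ℝ) ≤ R)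
    (hcont.mono Icc_subset_Ici_self) (show t ∈ Icc (g 0) (g R) from ⟨by linarith, hgR⟩)
  refine ⟨r, lt_of_le_of_ne hr.1 ?_, ?_⟩
  · rintro rfl
    linarith
  · rw [← hgr]
    exact (ENNReal.ofReal_toReal (measure_ne_top_of_subset sdiff_subset (hfin r))).symm

/-- Balls about prescribed centres can be disjointified into pieces of prescribed measure. -/
theorem exists_disjoint_pieces [Nontrivial E] :
    ∀ (N : ℕ) (c : Fin N → E) (t : Fin N → ℝ), (∀ k, 0 < t k) →
      ∃ (r : Fin N → ℝ) (S : Fin N → Set E), (∀ k, 0 < r k) ∧ (∀ k, MeasurableSet (S k)) ∧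
        (∀ k, S k ⊆ Metric.ball (c k) (r k)) ∧ Pairwise (Function.onFun Disjoint S) ∧
        (⋃ k, S k) = (⋃ k, Metric.ball (c k) (r k)) ∧ ∀ k, μ (S k) = ENNReal.ofReal (t k) := by
  intro N
  induction N with
  | zero =>
    intro c t _
    exact ⟨fun _ => 1, fun _ => ∅, fun k => k.elim0, fun k => k.elim0, fun k => k.elim0,
      fun k => k.elim0, by simp, fun k => k.elim0⟩
  | succ N ih =>
    intro c t ht
    obtain ⟨r, S, hr, hS, hSb, hdisj, hU, hm⟩ :=
      ih (fun k => c k.castSucc) (fun k => t k.castSucc) fun k => ht _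
    have hF : μ (⋃ k, S k) ≠ ⊤ := by
      refine ((measure_iUnion_le _).trans_lt ?_).ne
      rw [tsum_fintype]
      exact ENNReal.sum_lt_top.2 fun k _ => by rw [hm]; exact ENNReal.ofReal_lt_top
    obtain ⟨ρ, hρ, hρm⟩ := exists_radius_measure_ball_diff_eq μ (c (Fin.last N)) hF
      (ht (Fin.last N))
    refine ⟨Fin.snoc r ρ, Fin.snoc S (Metric.ball (c (Fin.last N)) ρ \ ⋃ k, S k),
      ?_, ?_, ?_, ?_, ?_, ?_⟩
    · exact Fin.lastCases (by simpa using hρ) (by simpa using hr)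
    · exact Fin.lastCases (by simpa using measurableSet_ball.diff (MeasurableSet.iUnion hS))
        (by simpa using hS)
    · refine Fin.lastCases ?_ fun k => ?_
      · simpa only [Fin.snoc_last] using sdiff_subset
      · simpa only [Fin.snoc_castSucc] using hSb k
    · intro i k
      induction i using Fin.lastCases with
      | last =>
        induction k using Fin.lastCases with
        | last => simp
        | cast k =>
          intro _
          simp only [Function.onFun, Fin.snoc_last, Fin.snoc_castSucc]
          exact disjoint_sdiff_left.mono_right (subset_iUnion S k)
      | cast i =>
        induction k using Fin.lastCases with
        | last =>
          intro _
          simp only [Function.onFun, Fin.snoc_last, Fin.snoc_castSucc]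
          exact disjoint_sdiff_right.mono_left (subset_iUnion S i)
        | cast k =>
          intro hik
          simp only [Function.onFun, Fin.snoc_castSucc]
          exact hdisj fun h => hik (by rw [h])
    · ext x
      simp only [mem_iUnion, Fin.exists_fin_succ', Fin.snoc_last, Fin.snoc_castSucc]
      have := Set.ext_iff.1 hU x
      simp only [mem_iUnion] at this
      rw [this, mem_sdiff, mem_iUnion, this]
      tauto
    · exact Fin.lastCases (by simpa using hρm) (by simpa using hm)

/-- Dilating finitely many balls by a factor `s ≥ 1` about their centres increases the measure of
their union by at most the factor `s ^ d`. -/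
theorem measure_iUnion_ball_dilate_le {N : ℕ} (c : Fin N → E) (r : Fin N → ℝ) {s : ℝ}
    (hs : 1 ≤ s) :
    μ (⋃ k, Metric.ball (c k) (s * r k)) ≤
      ENNReal.ofReal (s ^ Module.finrank ℝ E) * μ (⋃ k, Metric.ball (c k) (r k)) := by
  have hs0 : 0 < s := by linarith
  set φ : Fin N → E → ℝ := fun k x => ‖x - c k‖ - s * r k
  set A : Fin N → Set E := fun k => {x | (∀ i, φ k x ≤ φ i x) ∧ ∀ i < k, φ k x < φ i x}
  have hφ : ∀ k, Continuous (φ k) := fun k => by fun_prop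
  have hA : ∀ k, MeasurableSet (A k) := by
    intro k
    refine MeasurableSet.inter (s₁ := {x | ∀ i, φ k x ≤ φ i x})
      (s₂ := {x | ∀ i < k, φ k x < φ i x}) ?_ ?_
    · simp only [ofPred_forall]
      exact MeasurableSet.iInter fun i => measurableSet_le (hφ k).measurable (hφ i).measurable
    · simp only [ofPred_forall]
      exact MeasurableSet.iInter fun i => MeasurableSet.iInter fun _ =>
        measurableSet_lt (hφ k).measurable (hφ i).measurable
  have hdisj : ∀ i k, i < k → Disjoint (A i) (A k) := by
    intro i k hik
    rw [Set.disjoint_left]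
    intro x hi hk
    exact absurd (hk.2 i hik) (not_lt.2 (hi.1 k))
  have hdisj' : Pairwise (Function.onFun Disjoint A) := by
    intro i k hik
    rcases lt_or_gt_of_ne hik with h | h
    exacts [hdisj i k h, (hdisj k i h).symm]
  have hcover : (⋃ k, Metric.ball (c k) (s * r k)) ⊆
      ⋃ k, Metric.ball (c k) (s * r k) ∩ A k := by
    intro x hx
    obtain ⟨k₀, hk₀⟩ := mem_iUnion.1 hx
    have hne : (Finset.univ : Finset (Fin N)).Nonempty := ⟨k₀, Finset.mem_univ _⟩
    obtain ⟨m, -, hm⟩ := Finset.exists_min_image Finset.univ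
      (fun k => toLex (φ k x, k)) hne
    have hm' : ∀ i, φ m x < φ i x ∨ φ m x = φ i x ∧ m ≤ i := by
      intro i
      have := hm i (Finset.mem_univ _)
      simpa [Prod.Lex.toLex_le_toLex] using this
    refine mem_iUnion.2 ⟨m, ?_, ?_, ?_⟩
    · have h1 : φ k₀ x < 0 := by
        have := mem_ball_iff_norm.1 hk₀
        simp only [φ]; linarith
      have h2 : φ m x ≤ φ k₀ x := by rcases hm' k₀ with h | h <;> linarith [h]
      rw [mem_ball_iff_norm]
      have : φ m x < 0 := by linarith
      simp only [φ] at this; linarith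
    · intro i; rcases hm' i with h | h
      exacts [h.le, h.1.le]
    · intro i hi
      rcases hm' i with h | h
      exacts [h, absurd h.2 (not_le.2 hi)]
  have hpiece : ∀ k, μ (Metric.ball (c k) (s * r k) ∩ A k) ≤
      ENNReal.ofReal (s ^ Module.finrank ℝ E) * μ (Metric.ball (c k) (r k) ∩ A k) := by
    intro k
    have hsub : Metric.ball (c k) (s * r k) ∩ A k ⊆
        Set.image (AffineMap.homothety (c k) s) (Metric.ball (c k) (r k) ∩ A k) := by
      rintro x ⟨hxb, hx1, hx2⟩
      refine ⟨c k + s⁻¹ • (x - c k), ⟨?_, ?_, ?_⟩, ?_⟩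
      · rw [mem_ball_iff_norm] at hxb ⊢
        rw [add_sub_cancel_left, norm_smul, Real.norm_of_nonneg (by positivity),
          inv_mul_lt_iff₀ hs0]
        exact hxb
      · intro i
        have h1 := hx1 i
        have h2 := norm_shrink_sub_le (p := c k) (q := c i) (x := x) hs
        simp only [φ, add_sub_cancel_left] at h1 ⊢
        linarith
      · intro i hi
        have h1 := hx2 i hi
        have h2 := norm_shrink_sub_le (p := c k) (q := c i) (x := x) hs
        simp only [φ, add_sub_cancel_left] at h1 ⊢
        linarith
      · simp [AffineMap.homothety_apply, smul_smul, mul_inv_cancel₀ hs0.ne']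
    refine (measure_mono hsub).trans ?_
    rw [Measure.addHaar_image_homothety, abs_of_nonneg (by positivity)]
  calc μ (⋃ k, Metric.ball (c k) (s * r k))
      ≤ μ (⋃ k, Metric.ball (c k) (s * r k) ∩ A k) := measure_mono hcover
    _ ≤ ∑ k, μ (Metric.ball (c k) (s * r k) ∩ A k) :=
        (measure_iUnion_le _).trans_eq (tsum_fintype _)
    _ ≤ ∑ k, ENNReal.ofReal (s ^ Module.finrank ℝ E) * μ (Metric.ball (c k) (r k) ∩ A k) :=
        Finset.sum_le_sum fun k _ => hpiece k
    _ = ENNReal.ofReal (s ^ Module.finrank ℝ E) * μ (⋃ k, Metric.ball (c k) (r k) ∩ A k) := by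
        rw [measure_iUnion (fun i k hik => (hdisj' hik).mono inter_subset_right inter_subset_right)
          fun k => measurableSet_ball.inter (hA k), tsum_fintype, Finset.mul_sum]
    _ ≤ _ := by gcongr; exact inter_subset_left

end Geometry

section Kernel

theorem rieszConst_pos (n : ℕ) : 0 < rieszConst n := by
  have : 0 < Real.Gamma (((n : ℝ) + 1) / 2) := Real.Gamma_pos_of_pos (by positivity)
  unfold rieszConst
  positivity

theorem Real.Gamma_add_half_le {s : ℝ} (hs : 0 < s) :
    Real.Gamma (s + 1 / 2) ≤ Real.Gamma s * √s := by
  have h := Real.Gamma_mul_add_mul_le_rpow_Gamma_mul_rpow_Gamma hs (by linarith : 0 < s + 1)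
    (by norm_num : (0 : ℝ) < 1 / 2) (by norm_num : (0 : ℝ) < 1 / 2) (by norm_num)
  have hG := Real.Gamma_pos_of_pos hs
  rw [Real.Gamma_add_one hs.ne', Real.mul_rpow hs.le hG.le] at h
  have h2 : Real.Gamma s ^ (1 / 2 : ℝ) * Real.Gamma s ^ (1 / 2 : ℝ) = Real.Gamma s := by
    rw [← Real.rpow_add hG]; norm_num
  calc Real.Gamma (s + 1 / 2) = Real.Gamma (1 / 2 * s + 1 / 2 * (s + 1)) := by congr 1; ring
    _ ≤ _ := h
    _ = (Real.Gamma s ^ (1 / 2 : ℝ) * Real.Gamma s ^ (1 / 2 : ℝ)) * s ^ (1 / 2 : ℝ) := by ring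
    _ = _ := by rw [h2, Real.sqrt_eq_rpow]

/-- The normalizing constant times the area of the unit sphere is at most `√n`. -/
theorem rieszConst_mul_volume_ball_le {n : ℕ} (hn : 1 ≤ n) :
    rieszConst n * (n * volume.real (Metric.ball (0 : EuclideanSpace ℝ (Fin n)) 1)) ≤ √n := by
  have : Nonempty (Fin n) := ⟨⟨0, hn⟩⟩
  have hn0 : (0 : ℝ) < n := by exact_mod_cast hn
  have hG : 0 < Real.Gamma ((n : ℝ) / 2) := Real.Gamma_pos_of_pos (by positivity)
  have hpi := Real.pi_pos
  have hvol : volume.real (Metric.ball (0 : EuclideanSpace ℝ (Fin n)) 1) =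
      √Real.pi ^ n / (n / 2 * Real.Gamma ((n : ℝ) / 2)) := by
    rw [measureReal_def, EuclideanSpace.volume_ball]
    rw [Fintype.card_fin, Real.Gamma_add_one (by positivity), ENNReal.ofReal_one, one_pow, one_mul,
      ENNReal.toReal_ofReal (by positivity)]
  have hpow : Real.pi ^ (((n : ℝ) + 1) / 2) = √Real.pi ^ n * √Real.pi := by
    rw [← pow_succ, Real.sqrt_eq_rpow, ← Real.rpow_natCast, ← Real.rpow_mul hpi.le]
    congr 1; push_cast; ring
  have hGam : Real.Gamma (((n : ℝ) + 1) / 2) ≤ Real.Gamma ((n : ℝ) / 2) * √((n : ℝ) / 2) := by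
    have := Real.Gamma_add_half_le (s := (n : ℝ) / 2) (by positivity)
    convert this using 2; ring
  have hsq : 0 < √Real.pi := Real.sqrt_pos.2 hpi
  have h1 : rieszConst n * (n * volume.real (Metric.ball (0 : EuclideanSpace ℝ (Fin n)) 1)) =
      2 / √Real.pi * (Real.Gamma (((n : ℝ) + 1) / 2) / Real.Gamma ((n : ℝ) / 2)) := by
    rw [hvol, rieszConst, hpow]
    field_simp
  rw [h1]
  have h2 : Real.Gamma (((n : ℝ) + 1) / 2) / Real.Gamma ((n : ℝ) / 2) ≤ √((n : ℝ) / 2) := by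
    rw [div_le_iff₀ hG]; linarith
  have h3 : √((n : ℝ) / 2) * (2 / √Real.pi) ≤ √n := by
    rw [Real.sqrt_div hn0.le, div_mul_div_comm, div_le_iff₀ (by positivity),
      ← Real.sqrt_mul (by norm_num)]
    have : (2 : ℝ) ≤ √(2 * Real.pi) := Real.le_sqrt_of_sq_le (by nlinarith [Real.pi_gt_three])
    gcongr
  calc _ ≤ 2 / √Real.pi * √((n : ℝ) / 2) := by gcongr
    _ ≤ _ := by rw [mul_comm]; exact h3

theorem lintegral_radial {n : ℕ} (hn : 1 ≤ n) {s : Set ℝ} (hs : MeasurableSet s)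
    (hs0 : s ⊆ Ioi 0) {f : ℝ → ℝ} (hf : ∀ y ∈ s, 0 ≤ f y)
    (hi : IntegrableOn (fun y => y ^ (n - 1) * f y) s) :
    ∫⁻ x in {x : EuclideanSpace ℝ (Fin n) | ‖x‖ ∈ s}, ENNReal.ofReal (f ‖x‖) =
      ENNReal.ofReal (n * volume.real (Metric.ball (0 : EuclideanSpace ℝ (Fin n)) 1) *
        ∫ y in s, y ^ (n - 1) * f y) := by
  have : Nonempty (Fin n) := ⟨⟨0, hn⟩⟩
  have hms : MeasurableSet {x : EuclideanSpace ℝ (Fin n) | ‖x‖ ∈ s} := measurable_norm hs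
  have hdim : Module.finrank ℝ (EuclideanSpace ℝ (Fin n)) = n := by simp
  have hind : ∀ x : EuclideanSpace ℝ (Fin n),
      {x : EuclideanSpace ℝ (Fin n) | ‖x‖ ∈ s}.indicator (fun x => ENNReal.ofReal (f ‖x‖)) x =
        ENNReal.ofReal (s.indicator f ‖x‖) := by
    intro x
    by_cases h : ‖x‖ ∈ s <;> simp [h]
  have hprod : ∀ y, y ^ (n - 1) * s.indicator f y = s.indicator (fun y => y ^ (n - 1) * f y) y := by
    intro y
    by_cases h : y ∈ s <;> simp [h]
  have hInt : Integrable (fun x : EuclideanSpace ℝ (Fin n) => s.indicator f ‖x‖) := by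
    rw [integrable_fun_norm_addHaar, hdim]
    simp only [smul_eq_mul, hprod]
    exact (hi.integrable_indicator hs).integrableOn
  rw [← lintegral_indicator hms, lintegral_congr hind,
    ← ofReal_integral_eq_lintegral_ofReal hInt
      (Filter.Eventually.of_forall fun x => indicator_nonneg hf _),
    integral_fun_norm_addHaar, hdim]
  simp only [smul_eq_mul, hprod, nsmul_eq_mul]
  rw [setIntegral_indicator hs, inter_eq_self_of_subset_right hs0, mul_assoc]

theorem lintegral_coord_sq_mul {n : ℕ} (j : Fin n) {g : ℝ → ENNReal} (hg : Measurable g) :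
    n * ∫⁻ x : EuclideanSpace ℝ (Fin n), ENNReal.ofReal (x j ^ 2) * g ‖x‖ =
      ∫⁻ x : EuclideanSpace ℝ (Fin n), ENNReal.ofReal (‖x‖ ^ 2) * g ‖x‖ := by
  have hsymm : ∀ i : Fin n, ∫⁻ x : EuclideanSpace ℝ (Fin n), ENNReal.ofReal (x i ^ 2) * g ‖x‖ =
      ∫⁻ x : EuclideanSpace ℝ (Fin n), ENNReal.ofReal (x j ^ 2) * g ‖x‖ := by
    intro i
    have h := (LinearIsometryEquiv.piLpCongrLeft 2 ℝ ℝ (Equiv.swap i j)).measurePreserving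
    have h2 := h.lintegral_comp
      (f := fun x : EuclideanSpace ℝ (Fin n) => ENNReal.ofReal (x i ^ 2) * g ‖x‖) (by fun_prop)
    rw [← h2]
    simp [LinearIsometryEquiv.piLpCongrLeft_apply, Equiv.piCongrLeft']
  calc n * ∫⁻ x : EuclideanSpace ℝ (Fin n), ENNReal.ofReal (x j ^ 2) * g ‖x‖
      = ∑ i : Fin n, ∫⁻ x : EuclideanSpace ℝ (Fin n), ENNReal.ofReal (x i ^ 2) * g ‖x‖ := by
        simp [hsymm]
    _ = ∫⁻ x : EuclideanSpace ℝ (Fin n), ∑ i : Fin n, ENNReal.ofReal (x i ^ 2) * g ‖x‖ := by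
        rw [lintegral_finsetSum]
        intro i _
        fun_prop
    _ = _ := by
        refine lintegral_congr fun x => ?_
        rw [← Finset.sum_mul, EuclideanSpace.real_norm_sq_eq,
          ENNReal.ofReal_sum_of_nonneg fun i _ => sq_nonneg _]

/-- The kernel `c_n z_j / |z|^{n+1}` of the `j`-th Riesz transform. -/
noncomputable def rieszKernel (n : ℕ) (j : Fin n) (z : EuclideanSpace ℝ (Fin n)) : ℝ :=
  rieszConst n * (z j / ‖z‖ ^ (n + 1))

theorem measurable_rieszKernel (n : ℕ) (j : Fin n) : Measurable (rieszKernel n j) := by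
  unfold rieszKernel
  fun_prop

theorem EuclideanSpace.abs_apply_le_norm {n : ℕ} (z : EuclideanSpace ℝ (Fin n)) (j : Fin n) :
    |z j| ≤ ‖z‖ := by
  simpa using PiLp.norm_apply_le z j

theorem rieszDirac_eq_sum (n : ℕ) (j : Fin n) {N : ℕ} (c : Fin N → EuclideanSpace ℝ (Fin n))
    (a : Fin N → ℝ) (x : EuclideanSpace ℝ (Fin n)) :
    rieszDirac n j c a x = ∑ k, a k * rieszKernel n j (x - c k) := by
  simp only [rieszDirac, rieszKernel, Finset.mul_sum, PiLp.sub_apply]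
  refine Finset.sum_congr rfl fun k _ => by ring

theorem abs_rieszKernel_le {n : ℕ} (hn : 1 ≤ n) (j : Fin n) {z : EuclideanSpace ℝ (Fin n)}
    (hz : 0 < ‖z‖) :
    |rieszKernel n j z| ≤ rieszConst n / 2 * (√n * (z j ^ 2 / ‖z‖ ^ (n + 2)) +
      (√n)⁻¹ * (‖z‖ ^ n)⁻¹) := by
  have hc := rieszConst_pos n
  have hs : 0 < √(n : ℝ) := Real.sqrt_pos.2 (by exact_mod_cast hn)
  rw [rieszKernel, abs_mul, abs_of_pos hc, abs_div, abs_of_pos (pow_pos hz _)]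
  have key : √n * (z j ^ 2 / ‖z‖ ^ (n + 2)) + (√n)⁻¹ * (‖z‖ ^ n)⁻¹ - |z j| / ‖z‖ ^ (n + 1) * 2 =
      (√n * |z j| - ‖z‖) ^ 2 / (√n * ‖z‖ ^ (n + 2)) := by
    rw [← sq_abs (z j)]
    field_simp
    ring
  have hnn : 0 ≤ (√n * |z j| - ‖z‖) ^ 2 / (√n * ‖z‖ ^ (n + 2)) := by positivity
  calc rieszConst n * (|z j| / ‖z‖ ^ (n + 1))
      = rieszConst n / 2 * (|z j| / ‖z‖ ^ (n + 1) * 2) := by ring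
    _ ≤ _ := by gcongr; linarith

/-- The Riesz kernel has logarithmic mass on a spherical shell. -/
theorem lintegral_abs_rieszKernel_shell_le {n : ℕ} (hn : 1 ≤ n) (j : Fin n) {A B : ℝ} (hA : 0 < A)
    (hAB : A ≤ B) :
    ∫⁻ x in {x : EuclideanSpace ℝ (Fin n) | ‖x‖ ∈ Ioc A B}, ENNReal.ofReal |rieszKernel n j x| ≤
      ENNReal.ofReal (Real.log (B / A)) := by
  have hn0 : (0 : ℝ) < n := by exact_mod_cast hn
  have hc := rieszConst_pos n
  have hs : 0 < √(n : ℝ) := Real.sqrt_pos.2 hn0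
  have hB : 0 < B := hA.trans_le hAB
  set ω := (n : ℝ) * volume.real (Metric.ball (0 : EuclideanSpace ℝ (Fin n)) 1)
  have hω : 0 ≤ ω := by positivity
  have hlog : 0 ≤ Real.log (B / A) := Real.log_nonneg (by rwa [le_div_iff₀ hA, one_mul])
  set T := {x : EuclideanSpace ℝ (Fin n) | ‖x‖ ∈ Ioc A B}
  have hT : MeasurableSet T := measurable_norm measurableSet_Ioc
  have hpos : ∀ x ∈ T, 0 < ‖x‖ := fun x hx => hA.trans hx.1
  have hpoly : EqOn (fun y : ℝ => y ^ (n - 1) * (y ^ n)⁻¹) (fun y => y⁻¹) (Ioc A B) := by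
    intro y hy
    have hy0 : 0 < y := hA.trans hy.1
    obtain ⟨m, rfl⟩ : ∃ m, n = m + 1 := ⟨n - 1, by omega⟩
    simp only [Nat.add_sub_cancel]
    field_simp
    ring
  have hii : IntervalIntegrable (fun y : ℝ => y⁻¹) volume A B := by
    refine intervalIntegral.intervalIntegrable_inv (fun y hy => ?_) continuousOn_id
    rw [uIcc_of_le hAB] at hy
    exact (hA.trans_le hy.1).ne'
  have hrad : ∫⁻ x in T, ENNReal.ofReal ((‖x‖ ^ n)⁻¹) = ENNReal.ofReal (ω * Real.log (B / A)) := by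
    have h := lintegral_radial hn (s := Ioc A B) measurableSet_Ioc
      (fun y hy => hA.trans hy.1) (f := fun y => (y ^ n)⁻¹)
      (fun y hy => by have := hA.trans hy.1; positivity)
      ((integrableOn_congr_fun hpoly measurableSet_Ioc).2
        ((intervalIntegrable_iff_integrableOn_Ioc_of_le hAB).1 hii))
    rw [h, setIntegral_congr_fun measurableSet_Ioc hpoly, ← intervalIntegral.integral_of_le hAB,
      integral_inv_of_pos hA hB]
  have hcoord : ∫⁻ x in T, ENNReal.ofReal (x j ^ 2 / ‖x‖ ^ (n + 2)) =
      ENNReal.ofReal (ω * Real.log (B / A) / n) := by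
    set g : ℝ → ENNReal := (Ioc A B).indicator fun y => ENNReal.ofReal ((y ^ (n + 2))⁻¹)
    have hg : Measurable g := Measurable.indicator (by fun_prop) measurableSet_Ioc
    have h := lintegral_coord_sq_mul j hg
    have e1 : ∀ x : EuclideanSpace ℝ (Fin n), ENNReal.ofReal (x j ^ 2) * g ‖x‖ =
        T.indicator (fun x => ENNReal.ofReal (x j ^ 2 / ‖x‖ ^ (n + 2))) x := by
      intro x
      by_cases hx : ‖x‖ ∈ Ioc A B
      · simp only [g, T, indicator_of_mem hx]
        rw [indicator_of_mem (show x ∈ {x : EuclideanSpace ℝ (Fin n) | ‖x‖ ∈ Ioc A B} from hx),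
          ← ENNReal.ofReal_mul (sq_nonneg _), div_eq_mul_inv]
      · simp only [g, T, indicator_of_notMem hx]
        rw [indicator_of_notMem (show x ∉ {x : EuclideanSpace ℝ (Fin n) | ‖x‖ ∈ Ioc A B} from hx),
          mul_zero]
    have e2 : ∀ x : EuclideanSpace ℝ (Fin n), ENNReal.ofReal (‖x‖ ^ 2) * g ‖x‖ =
        T.indicator (fun x => ENNReal.ofReal ((‖x‖ ^ n)⁻¹)) x := by
      intro x
      by_cases hx : ‖x‖ ∈ Ioc A B
      · have hx0 : 0 < ‖x‖ := hA.trans hx.1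
        simp only [g, T, indicator_of_mem hx]
        rw [indicator_of_mem (show x ∈ {x : EuclideanSpace ℝ (Fin n) | ‖x‖ ∈ Ioc A B} from hx),
          ← ENNReal.ofReal_mul (sq_nonneg _)]
        congr 1
        field_simp
        ring
      · simp only [g, T, indicator_of_notMem hx]
        rw [indicator_of_notMem (show x ∉ {x : EuclideanSpace ℝ (Fin n) | ‖x‖ ∈ Ioc A B} from hx),
          mul_zero]
    rw [lintegral_congr e1, lintegral_congr e2, lintegral_indicator hT, lintegral_indicator hT,
      hrad] at h
    rw [ENNReal.ofReal_div_of_pos hn0, ENNReal.ofReal_natCast, ← h,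
      mul_comm, ENNReal.mul_div_cancel_right (by exact_mod_cast hn0.ne') (ENNReal.natCast_ne_top n)]
  have hm1 : Measurable fun x : EuclideanSpace ℝ (Fin n) =>
      ENNReal.ofReal (x j ^ 2 / ‖x‖ ^ (n + 2)) := by fun_prop
  have hm2 : Measurable fun x : EuclideanSpace ℝ (Fin n) => ENNReal.ofReal ((‖x‖ ^ n)⁻¹) := by
    fun_prop
  calc ∫⁻ x in T, ENNReal.ofReal |rieszKernel n j x|
      ≤ ∫⁻ x in T, ENNReal.ofReal (rieszConst n / 2) *
          (ENNReal.ofReal √n * ENNReal.ofReal (x j ^ 2 / ‖x‖ ^ (n + 2)) +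
            ENNReal.ofReal (√n)⁻¹ * ENNReal.ofReal ((‖x‖ ^ n)⁻¹)) := by
        refine setLIntegral_mono' hT fun x hx => ?_
        have := hpos x hx
        rw [← ENNReal.ofReal_mul hs.le, ← ENNReal.ofReal_mul (by positivity),
          ← ENNReal.ofReal_add (by positivity) (by positivity),
          ← ENNReal.ofReal_mul (by positivity)]
        exact ENNReal.ofReal_le_ofReal (abs_rieszKernel_le hn j this)
    _ = ENNReal.ofReal (rieszConst n / 2) *
          (ENNReal.ofReal √n * ENNReal.ofReal (ω * Real.log (B / A) / n) +
            ENNReal.ofReal (√n)⁻¹ * ENNReal.ofReal (ω * Real.log (B / A))) := by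
        rw [lintegral_const_mul _ (by fun_prop), lintegral_add_left (by fun_prop),
          lintegral_const_mul _ hm1, lintegral_const_mul _ hm2, hrad, hcoord]
    _ = ENNReal.ofReal (rieszConst n / 2 * (√n * (ω * Real.log (B / A) / n) +
          (√n)⁻¹ * (ω * Real.log (B / A)))) := by
        rw [← ENNReal.ofReal_mul hs.le, ← ENNReal.ofReal_mul (by positivity),
          ← ENNReal.ofReal_add (by positivity) (by positivity),
          ← ENNReal.ofReal_mul (by positivity)]
    _ ≤ _ := by
        refine ENNReal.ofReal_le_ofReal ?_
        have h1 : rieszConst n / 2 * (√n * (ω * Real.log (B / A) / n) +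
          (√n)⁻¹ * (ω * Real.log (B / A))) = (rieszConst n * ω) / √n * Real.log (B / A) := by
          have : (n : ℝ) = √n * √n := (Real.mul_self_sqrt hn0.le).symm
          have h2 : √n * (ω * Real.log (B / A) / n) = (√n)⁻¹ * (ω * Real.log (B / A)) := by
            rw [eq_inv_mul_iff_mul_eq₀ hs.ne', ← mul_assoc, ← this]
            field_simp
          rw [h2]
          field_simp
          ring
        rw [h1]
        have h3 : (rieszConst n * ω) / √n ≤ 1 := by
          rw [div_le_one hs]
          exact rieszConst_mul_volume_ball_le hn
        exact mul_le_of_le_one_left hlog h3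

theorem lintegral_norm_inv_pow_succ {n : ℕ} (hn : 1 ≤ n) {R : ℝ} (hR : 0 < R) :
    ∫⁻ x in {x : EuclideanSpace ℝ (Fin n) | ‖x‖ ∈ Ioi R}, ENNReal.ofReal ((‖x‖ ^ (n + 1))⁻¹) =
      ENNReal.ofReal (n * volume.real (Metric.ball (0 : EuclideanSpace ℝ (Fin n)) 1) * R⁻¹) := by
  have hpoly : EqOn (fun y : ℝ => y ^ (n - 1) * (y ^ (n + 1))⁻¹) (fun y => y ^ (-2 : ℝ))
      (Ioi R) := by
    intro y hy
    have hy0 : 0 < y := hR.trans hy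
    obtain ⟨m, rfl⟩ : ∃ m, n = m + 1 := ⟨n - 1, by omega⟩
    simp only [Nat.add_sub_cancel]
    rw [Real.rpow_neg hy0.le, show (2 : ℝ) = (2 : ℕ) by norm_num, Real.rpow_natCast]
    field_simp
    ring
  have h := lintegral_radial hn (s := Ioi R) measurableSet_Ioi
      (fun y hy => hR.trans hy) (f := fun y => (y ^ (n + 1))⁻¹)
      (fun y hy => by have : 0 < y := hR.trans hy; positivity)
      ((integrableOn_congr_fun hpoly measurableSet_Ioi).2
        (integrableOn_Ioi_rpow_of_lt (by norm_num) hR))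
  rw [h, setIntegral_congr_fun measurableSet_Ioi hpoly, integral_Ioi_rpow_of_lt (by norm_num) hR]
  norm_num [Real.rpow_neg_one]

end Kernel

section Regularity

theorem one_add_inv_pow_le_three {n : ℕ} (hn : 1 ≤ n) : (1 + (n : ℝ)⁻¹) ^ n ≤ 3 := by
  have hn0 : (0 : ℝ) < n := by exact_mod_cast hn
  calc (1 + (n : ℝ)⁻¹) ^ n ≤ (Real.exp (n : ℝ)⁻¹) ^ n := by
        gcongr
        rw [add_comm]
        exact Real.add_one_le_exp _
    _ = Real.exp 1 := by rw [← Real.exp_nat_mul, mul_inv_cancel₀ hn0.ne']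
    _ ≤ 3 := by linarith [Real.exp_one_lt_d9]

theorem mul_abs_inv_pow_sub_le {n : ℕ} (hn : 2 ≤ n) {R ρ d : ℝ} (hR : 0 < R)
    (hρd : |R - ρ| ≤ d) (hd : n ^ 2 * d ≤ R) :
    0 < ρ ∧ ρ * |(R ^ (n + 1))⁻¹ - (ρ ^ (n + 1))⁻¹| ≤ 3 * (n + 1) * d * (R ^ (n + 1))⁻¹ := by
  have hn2 : (2 : ℝ) ≤ n := by exact_mod_cast hn
  have hd0 : 0 ≤ d := (abs_nonneg _).trans hρd
  obtain ⟨h1, h2⟩ := abs_le.1 hρd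
  have hnd : n * d ≤ ρ := by nlinarith [mul_nonneg hd0 (by nlinarith : (0 : ℝ) ≤ n ^ 2 - 1 - n)]
  have hρ : 0 < ρ := by nlinarith [mul_nonneg hd0 (by nlinarith : (0 : ℝ) ≤ n ^ 2 - 1 - n)]
  refine ⟨hρ, ?_⟩
  have hmax : max |ρ| |R| ≤ ρ * (1 + (n : ℝ)⁻¹) := by
    have hd' : d ≤ ρ * (n : ℝ)⁻¹ := by
      rw [← div_eq_mul_inv, le_div_iff₀ (by linarith)]; linarith
    rw [abs_of_pos hρ, abs_of_pos hR, max_le_iff]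
    constructor <;> linarith
  have h3 : |ρ ^ (n + 1) - R ^ (n + 1)| ≤ 3 * (n + 1) * d * ρ ^ n := by
    calc |ρ ^ (n + 1) - R ^ (n + 1)| ≤ |ρ - R| * ((n + 1 : ℕ) : ℝ) * max |ρ| |R| ^ (n + 1 - 1) :=
          abs_pow_sub_pow_le _ _ _
      _ ≤ d * (n + 1) * (ρ * (1 + (n : ℝ)⁻¹)) ^ n := by
          rw [abs_sub_comm]
          push_cast
          gcongr
      _ = (d * (n + 1) * ρ ^ n) * (1 + (n : ℝ)⁻¹) ^ n := by rw [mul_pow]; ring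
      _ ≤ (d * (n + 1) * ρ ^ n) * 3 := by
          gcongr
          exact one_add_inv_pow_le_three (by omega)
      _ = _ := by ring
  have h4 : ρ * |(R ^ (n + 1))⁻¹ - (ρ ^ (n + 1))⁻¹| =
      |ρ ^ (n + 1) - R ^ (n + 1)| * ((ρ ^ n)⁻¹ * (R ^ (n + 1))⁻¹) := by
    rw [inv_sub_inv (by positivity) (by positivity), abs_div,
      abs_of_pos (by positivity : 0 < R ^ (n + 1) * ρ ^ (n + 1))]
    field_simp
    ring
  rw [h4]
  calc _ ≤ 3 * (n + 1) * d * ρ ^ n * ((ρ ^ n)⁻¹ * (R ^ (n + 1))⁻¹) := by gcongr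
    _ = _ := by field_simp

theorem abs_rieszKernel_sub_le {n : ℕ} (hn : 2 ≤ n) (j : Fin n) {x y : EuclideanSpace ℝ (Fin n)}
    (hx : 0 < ‖x‖) (hy : n ^ 2 * ‖y‖ ≤ ‖x‖) :
    |rieszKernel n j x - rieszKernel n j (x - y)| ≤
      rieszConst n * ((3 * n + 4) * ‖y‖) * (‖x‖ ^ (n + 1))⁻¹ := by
  have hc := rieszConst_pos n
  have hd : |‖x‖ - ‖x - y‖| ≤ ‖y‖ := by simpa using abs_norm_sub_norm_le x (x - y)
  obtain ⟨hz, h⟩ := mul_abs_inv_pow_sub_le hn hx hd hy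
  have e : rieszKernel n j x - rieszKernel n j (x - y) = rieszConst n *
      (y j * (‖x‖ ^ (n + 1))⁻¹ +
        (x - y) j * ((‖x‖ ^ (n + 1))⁻¹ - (‖x - y‖ ^ (n + 1))⁻¹)) := by
    simp only [rieszKernel, PiLp.sub_apply]
    ring
  rw [e, abs_mul, abs_of_pos hc, mul_assoc]
  gcongr
  refine (abs_add_le _ _).trans ?_
  rw [abs_mul, abs_mul, abs_of_pos (by positivity : 0 < (‖x‖ ^ (n + 1))⁻¹)]
  calc _ ≤ ‖y‖ * (‖x‖ ^ (n + 1))⁻¹ +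
        ‖x - y‖ * |(‖x‖ ^ (n + 1))⁻¹ - (‖x - y‖ ^ (n + 1))⁻¹| := by
        gcongr
        · exact EuclideanSpace.abs_apply_le_norm y j
        · exact EuclideanSpace.abs_apply_le_norm (x - y) j
    _ ≤ ‖y‖ * (‖x‖ ^ (n + 1))⁻¹ + 3 * (n + 1) * ‖y‖ * (‖x‖ ^ (n + 1))⁻¹ := by gcongr
    _ = _ := by ring

/-- Hörmander's regularity integral of the Riesz kernel over the complement of the ball dilated by
`1 + 1/n` is at most a multiple of `log n`. -/
theorem lintegral_abs_rieszKernel_sub_le {n : ℕ} (hn : 2 ≤ n) (j : Fin n) {r : ℝ}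
    {y : EuclideanSpace ℝ (Fin n)} (hy : ‖y‖ < r) :
    ∫⁻ x in {x : EuclideanSpace ℝ (Fin n) | (1 + (n : ℝ)⁻¹) * r ≤ ‖x‖},
      ENNReal.ofReal |rieszKernel n j x - rieszKernel n j (x - y)| ≤
        ENNReal.ofReal (14 * Real.log n) := by
  have hn2 : (2 : ℝ) ≤ n := by exact_mod_cast hn
  have hn0 : (0 : ℝ) < n := by linarith
  have hr : 0 < r := (norm_nonneg y).trans_lt hy
  have hc := rieszConst_pos n
  have hlog2 : Real.log 2 ≤ Real.log n := Real.log_le_log (by norm_num) hn2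
  have hlog : 5 ≤ 8 * Real.log n := by linarith [Real.log_two_gt_d9]
  have hlog0 : 0 ≤ Real.log n := by linarith
  set K := rieszKernel n j
  have hK : Measurable K := measurable_rieszKernel n j
  set ω := (n : ℝ) * volume.real (Metric.ball (0 : EuclideanSpace ℝ (Fin n)) 1)
  have hω : 0 ≤ ω := by positivity
  set P := {x : EuclideanSpace ℝ (Fin n) | ‖x‖ ∈ Ioc r (n ^ 2 * r)}
  set Q := {x : EuclideanSpace ℝ (Fin n) | ‖x‖ ∈ Ioc (r / n) ((n ^ 2 + 1) * r)}
  set F := {x : EuclideanSpace ℝ (Fin n) | ‖x‖ ∈ Ioi (n ^ 2 * r)}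
  set T := {x : EuclideanSpace ℝ (Fin n) | (1 + (n : ℝ)⁻¹) * r ≤ ‖x‖}
  have hP : MeasurableSet P := measurable_norm measurableSet_Ioc
  have hQ : MeasurableSet Q := measurable_norm measurableSet_Ioc
  have hF : MeasurableSet F := measurable_norm measurableSet_Ioi
  have hT : MeasurableSet T := measurable_norm measurableSet_Ici
  have hbound : ∀ x ∈ T, ENNReal.ofReal |K x - K (x - y)| ≤
      P.indicator (fun x => ENNReal.ofReal |K x|) x +
        Q.indicator (fun x => ENNReal.ofReal |K x|) (x - y) +
        F.indicator (fun x => ENNReal.ofReal (rieszConst n * ((3 * n + 4) * r)) *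
          ENNReal.ofReal ((‖x‖ ^ (n + 1))⁻¹)) x := by
    intro x hx
    have hx' : (1 + (n : ℝ)⁻¹) * r ≤ ‖x‖ := hx
    have hxr : r + r / n ≤ ‖x‖ := by rw [div_eq_inv_mul]; linarith
    have hrn : 0 < r / n := by positivity
    by_cases hxF : n ^ 2 * r < ‖x‖
    · rw [indicator_of_mem (show x ∈ F from hxF)]
      refine le_trans ?_ le_add_self
      rw [← ENNReal.ofReal_mul (by positivity)]
      refine ENNReal.ofReal_le_ofReal ((abs_rieszKernel_sub_le hn j (by linarith) ?_).trans ?_)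
      · exact (mul_le_mul_of_nonneg_left hy.le (by positivity)).trans hxF.le
      · gcongr
    · push Not at hxF
      have hxP : x ∈ P := ⟨by linarith, hxF⟩
      have hxQ : x - y ∈ Q := by
        constructor
        · have := norm_sub_norm_le x y
          linarith
        · have := norm_sub_le x y
          linarith
      rw [indicator_of_mem hxP, indicator_of_mem hxQ]
      refine le_trans ?_ le_self_add
      rw [← ENNReal.ofReal_add (abs_nonneg _) (abs_nonneg _)]
      exact ENNReal.ofReal_le_ofReal (abs_sub _ _)
  have hn3 : (n : ℝ) ^ 2 * r / r = n ^ 2 := by field_simp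
  have hn4 : ((n : ℝ) ^ 2 + 1) * r / (r / n) = (n ^ 2 + 1) * n := by field_simp
  have hIP : ∫⁻ x in P, ENNReal.ofReal |K x| ≤ ENNReal.ofReal (2 * Real.log n) := by
    refine (lintegral_abs_rieszKernel_shell_le (by omega) j hr
      (le_mul_of_one_le_left hr.le (by nlinarith))).trans_eq ?_
    rw [hn3, Real.log_pow]
    norm_num
  have hIQ : ∫⁻ x in Q, ENNReal.ofReal |K x| ≤ ENNReal.ofReal (4 * Real.log n) := by
    refine (lintegral_abs_rieszKernel_shell_le (by omega) j (by positivity) ?_).trans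
      (ENNReal.ofReal_le_ofReal ?_)
    · rw [div_le_iff₀ hn0]; nlinarith [mul_pos hr hn0]
    · rw [hn4, show (4 : ℝ) = (4 : ℕ) by norm_num, ← Real.log_pow]
      refine Real.log_le_log (by positivity) ?_
      have : (n : ℝ) ^ 2 + 1 ≤ n ^ 3 := by nlinarith
      nlinarith
  have hIF : ∫⁻ x in F, ENNReal.ofReal (rieszConst n * ((3 * n + 4) * r)) *
      ENNReal.ofReal ((‖x‖ ^ (n + 1))⁻¹) ≤ ENNReal.ofReal (8 * Real.log n) := by
    rw [lintegral_const_mul _ (by fun_prop), lintegral_norm_inv_pow_succ (by omega) (by positivity),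
      ← ENNReal.ofReal_mul (by positivity)]
    refine ENNReal.ofReal_le_ofReal (le_trans ?_ hlog)
    have h1 : rieszConst n * ω ≤ n :=
      (rieszConst_mul_volume_ball_le (by omega)).trans
        (Real.sqrt_le_self_iff.2 (Or.inr (by linarith)))
    calc rieszConst n * ((3 * n + 4) * r) * (ω * ((n : ℝ) ^ 2 * r)⁻¹)
        = (rieszConst n * ω) * ((3 * n + 4) / n ^ 2) := by field_simp
      _ ≤ n * ((3 * n + 4) / n ^ 2) := by gcongr
      _ = (3 * n + 4) / n := by field_simp
      _ ≤ 5 := by rw [div_le_iff₀ hn0]; linarith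
  calc ∫⁻ x in T, ENNReal.ofReal |K x - K (x - y)|
      ≤ ∫⁻ x in T, _ := setLIntegral_mono' hT hbound
    _ ≤ ∫⁻ x, _ := setLIntegral_le_lintegral _ _
    _ = (∫⁻ x, P.indicator (fun x => ENNReal.ofReal |K x|) x) +
        (∫⁻ x, Q.indicator (fun x => ENNReal.ofReal |K x|) (x - y)) +
        ∫⁻ x, F.indicator (fun x => ENNReal.ofReal (rieszConst n * ((3 * n + 4) * r)) *
          ENNReal.ofReal ((‖x‖ ^ (n + 1))⁻¹)) x := by
        have m1 : Measurable (P.indicator fun x => ENNReal.ofReal |K x|) :=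
          Measurable.indicator (by fun_prop) hP
        have m2 : Measurable (Q.indicator fun x => ENNReal.ofReal |K x|) :=
          Measurable.indicator (by fun_prop) hQ
        rw [lintegral_add_left (by fun_prop), lintegral_add_left m1]
    _ ≤ ENNReal.ofReal (2 * Real.log n) + ENNReal.ofReal (4 * Real.log n) +
        ENNReal.ofReal (8 * Real.log n) := by
        rw [lintegral_sub_right_eq_self (Q.indicator fun x => ENNReal.ofReal |K x|) y,
          lintegral_indicator hP, lintegral_indicator hQ, lintegral_indicator hF]
        gcongr
    _ = _ := by
        rw [← ENNReal.ofReal_add (by positivity) (by positivity),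
          ← ENNReal.ofReal_add (by positivity) (by positivity)]
        congr 1
        ring

end Regularity

section Fourier

open scoped FourierTransform Convolution

variable {V : Type*} [NormedAddCommGroup V] [InnerProductSpace ℝ V] [FiniteDimensional ℝ V]
  [MeasurableSpace V] [BorelSpace V]

theorem norm_fourier_le_integral_norm (f : V → ℂ) (ξ : V) : ‖𝓕 f ξ‖ ≤ ∫ x, ‖f x‖ :=
  VectorFourier.norm_fourierIntegral_le_integral_norm _ _ _ _ _

theorem lintegral_norm_sq_fourier_eq {h : V → ℂ} (hc : Continuous h) (hi : Integrable h)
    (hF : Integrable (𝓕 h)) :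
    ∫⁻ x, ENNReal.ofReal (‖𝓕 h x‖ ^ 2) = ∫⁻ x, ENNReal.ofReal (‖h x‖ ^ 2) := by
  have hinv := hc.fourierInv_fourier_eq hi hF
  have hFc : Continuous (𝓕 h) :=
    VectorFourier.fourierIntegral_continuous Real.continuous_fourierChar
      (by exact continuous_inner) hi
  have hb : ∀ x, ‖h x‖ ≤ ∫ ξ, ‖𝓕 h ξ‖ := by
    intro x
    rw [← congrFun hinv x, Real.fourierInv_eq_fourier_neg]
    exact norm_fourier_le_integral_norm _ _
  have hi2 : Integrable fun x => ‖h x‖ ^ 2 := by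
    refine (hi.norm.const_mul (∫ ξ, ‖𝓕 h ξ‖)).mono' (by fun_prop) (.of_forall fun x => ?_)
    rw [Real.norm_of_nonneg (by positivity), sq]
    exact mul_le_mul_of_nonneg_right (hb x) (norm_nonneg _)
  have hF2 : Integrable fun x => ‖𝓕 h x‖ ^ 2 := by
    refine (hF.norm.const_mul (∫ x, ‖h x‖)).mono' (by fun_prop) (.of_forall fun x => ?_)
    rw [Real.norm_of_nonneg (by positivity), sq]
    exact mul_le_mul_of_nonneg_right (norm_fourier_le_integral_norm h x) (norm_nonneg _)
  rw [← ofReal_integral_eq_lintegral_ofReal hi2 (.of_forall fun _ => by positivity),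
    ← ofReal_integral_eq_lintegral_ofReal hF2 (.of_forall fun _ => by positivity)]
  congr 1
  have key : ∫ ξ, innerSL ℂ (𝓕 h ξ) (𝓕 h ξ) = ∫ x, innerSL ℂ (h x) (𝓕⁻ (𝓕 h) x) := by
    have := VectorFourier.integral_sesq_fourierIntegral_eq_neg_flip (innerSL ℂ (E := ℂ))
      (L := innerₗ V) (μ := volume) (ν := volume) Real.continuous_fourierChar continuous_inner hi hF
    rw [flip_innerₗ] at this
    exact this
  rw [hinv] at key
  apply Complex.ofRealLI.injective
  simpa [← LinearIsometry.integral_comp_comm, inner_self_eq_norm_sq_to_K] using key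

theorem lintegral_norm_sq_convolution_le {f k g : V → ℂ} {C : ℝ} (hf : Integrable f)
    (hf1 : ∀ x, ‖f x‖ ≤ 1) (hk : Integrable k) (hkc : Continuous k) {Bk : ℝ} (hkb : ∀ x, ‖k x‖ ≤ Bk)
    (hg : Integrable g) (hgc : Continuous g) {Bg : ℝ} (hgb : ∀ x, ‖g x‖ ≤ Bg)
    (hg1 : ∫ x, ‖g x‖ ≤ 1) (hFg : Integrable (𝓕 g))
    (hkg : ∀ ξ, ‖𝓕 k ξ‖ ≤ C * ‖𝓕 g ξ‖) :
    ∫⁻ x, ENNReal.ofReal (‖(f ⋆[ContinuousLinearMap.mul ℂ ℂ] k) x‖ ^ 2) ≤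
      ENNReal.ofReal (C ^ 2 * ∫ x, ‖f x‖) := by
  set L := ContinuousLinearMap.mul ℂ ℂ
  have hFc : ∀ {u : V → ℂ}, Integrable u → Continuous (𝓕 u) := fun hu =>
    VectorFourier.fourierIntegral_continuous Real.continuous_fourierChar
      (by exact continuous_inner) hu
  have hconv : ∀ {u : V → ℂ}, Integrable u → 𝓕 (f ⋆[L] u) = fun ξ => 𝓕 f ξ * 𝓕 u ξ :=
    fun hu => funext fun ξ => Real.fourier_mul_convolution_eq hf hu ξ
  have hmul : ∀ {u : V → ℂ}, Integrable (𝓕 u) → Integrable (fun ξ => 𝓕 f ξ * 𝓕 u ξ) := fun hu =>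
    hu.bdd_mul (hFc hf).aestronglyMeasurable (.of_forall (norm_fourier_le_integral_norm f))
  have hpl : ∀ {u : V → ℂ} {B : ℝ}, Integrable u → Continuous u → (∀ x, ‖u x‖ ≤ B) →
      Integrable (𝓕 u) → ∫⁻ x, ENNReal.ofReal (‖(f ⋆[L] u) x‖ ^ 2) =
        ∫⁻ ξ, ENNReal.ofReal (‖𝓕 f ξ * 𝓕 u ξ‖ ^ 2) := by
    intro u B hu huc hub hFu
    have h := lintegral_norm_sq_fourier_eq (h := f ⋆[L] u)
      (BddAbove.continuous_convolution_right_of_integrable L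
        ⟨B, by rintro _ ⟨x, rfl⟩; exact hub x⟩ hf huc)
      (hf.integrable_convolution L hu) (by rw [hconv hu]; exact hmul hFu)
    rw [← h, hconv hu]
  have hFk : Integrable (𝓕 k) :=
    (hFg.norm.const_mul C).mono' (hFc hk).aestronglyMeasurable (.of_forall hkg)
  have hptw : ∀ x, ‖(f ⋆[L] g) x‖ ≤
      ((fun x => ‖f x‖) ⋆[ContinuousLinearMap.mul ℝ ℝ] (fun x => ‖g x‖)) x := by
    intro x
    refine (norm_integral_le_integral_norm _).trans_eq ?_
    simp [L, convolution_def]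
  have hptw1 : ∀ x, ‖(f ⋆[L] g) x‖ ≤ 1 := by
    intro x
    refine (hptw x).trans (le_trans ?_ hg1)
    rw [convolution_def, ← integral_sub_left_eq_self (fun t => ‖g t‖) volume x]
    refine integral_mono_of_nonneg (.of_forall fun t => by simp; positivity)
      (hg.norm.comp_sub_left x) (.of_forall fun t => ?_)
    simpa using mul_le_of_le_one_left (norm_nonneg (g (x - t))) (hf1 t)
  have hfg := hf.integrable_convolution L hg
  have hInt : ∫ x, ‖(f ⋆[L] g) x‖ ≤ ∫ x, ‖f x‖ := by
    refine (integral_mono hfg.norm (hf.norm.integrable_convolution _ hg.norm) hptw).trans ?_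
    rw [integral_convolution _ hf.norm hg.norm]
    exact mul_le_of_le_one_right (integral_nonneg fun _ => norm_nonneg _) hg1
  calc ∫⁻ x, ENNReal.ofReal (‖(f ⋆[L] k) x‖ ^ 2)
      = ∫⁻ ξ, ENNReal.ofReal (‖𝓕 f ξ * 𝓕 k ξ‖ ^ 2) := hpl hk hkc hkb hFk
    _ ≤ ∫⁻ ξ, ENNReal.ofReal (C ^ 2) * ENNReal.ofReal (‖𝓕 f ξ * 𝓕 g ξ‖ ^ 2) := by
        refine lintegral_mono fun ξ => ?_
        rw [← ENNReal.ofReal_mul (by positivity), ← mul_pow, norm_mul, norm_mul]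
        refine ENNReal.ofReal_le_ofReal (pow_le_pow_left₀ (by positivity) ?_ 2)
        calc _ ≤ ‖𝓕 f ξ‖ * (C * ‖𝓕 g ξ‖) := by gcongr; exact hkg ξ
          _ = _ := by ring
    _ = ENNReal.ofReal (C ^ 2) * ∫⁻ x, ENNReal.ofReal (‖(f ⋆[L] g) x‖ ^ 2) := by
        rw [lintegral_const_mul' _ _ ENNReal.ofReal_ne_top, hpl hg hgc hgb hFg]
    _ ≤ ENNReal.ofReal (C ^ 2) * ∫⁻ x, ENNReal.ofReal ‖(f ⋆[L] g) x‖ := by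
        gcongr with x
        rw [sq]
        exact mul_le_of_le_one_left (norm_nonneg _) (hptw1 x)
    _ = ENNReal.ofReal (C ^ 2 * ∫ x, ‖(f ⋆[L] g) x‖) := by
        rw [← ofReal_integral_eq_lintegral_ofReal hfg.norm (.of_forall fun _ => norm_nonneg _),
          ENNReal.ofReal_mul (by positivity)]
    _ ≤ _ := by gcongr

end Fourier

section Gaussian

open scoped FourierTransform

theorem abs_mul_exp_neg_mul_sq_le {a : ℝ} (ha : 0 < a) (t : ℝ) :
    |t| * Real.exp (-a * t ^ 2) ≤ (1 + 2 / a) * Real.exp (-(a / 2) * t ^ 2) := by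
  have h1 : |t| ≤ (1 + 2 / a) * Real.exp (a / 2 * t ^ 2) := by
    have h2 : a / 2 * t ^ 2 + 1 ≤ Real.exp (a / 2 * t ^ 2) := Real.add_one_le_exp _
    have h3 : |t| ≤ 1 + t ^ 2 := by nlinarith [sq_abs t, sq_nonneg (|t| - 1)]
    calc |t| ≤ 1 + t ^ 2 := h3
      _ ≤ 1 + t ^ 2 + (a / 2 * t ^ 2 + 2 / a) := by
        have : 0 ≤ a / 2 * t ^ 2 + 2 / a := by positivity
        linarith
      _ = (1 + 2 / a) * (a / 2 * t ^ 2 + 1) := by field_simp; ring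
      _ ≤ _ := by gcongr
  calc |t| * Real.exp (-a * t ^ 2)
      ≤ (1 + 2 / a) * Real.exp (a / 2 * t ^ 2) * Real.exp (-a * t ^ 2) := by gcongr
    _ = _ := by rw [mul_assoc, ← Real.exp_add]; ring_nf

theorem integral_rpow_neg_three_halves_mul_exp {c : ℝ} (hc : 0 < c) :
    ∫ s in Ioi (0 : ℝ), s ^ (-(3 / 2) : ℝ) * Real.exp (-(c / s)) = Real.sqrt (Real.pi / c) := by
  have h := Real.integral_rpow_mul_exp_neg_mul_Ioi (a := 1 / 2) (by norm_num) hc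
  rw [← integral_comp_rpow_Ioi (fun t => t ^ ((1 / 2 : ℝ) - 1) * Real.exp (-(c * t)))
    (p := -1) (by norm_num)] at h
  rw [Real.Gamma_one_half_eq, ← Real.sqrt_eq_rpow, ← Real.sqrt_mul (by positivity),
    one_div_mul_eq_div] at h
  rw [← h]
  refine setIntegral_congr_fun measurableSet_Ioi fun s (hs : 0 < s) => ?_
  simp only [abs_neg, abs_one, one_mul, smul_eq_mul]
  rw [← mul_assoc, ← Real.rpow_mul hs.le, ← Real.rpow_add hs, Real.rpow_neg_one, ← div_eq_mul_inv]
  norm_num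

theorem integrableOn_rpow_neg_three_halves_mul_exp {c : ℝ} (hc : 0 < c) :
    IntegrableOn (fun s : ℝ => s ^ (-(3 / 2) : ℝ) * Real.exp (-(c / s))) (Ioi 0) :=
  .of_integral_ne_zero (by rw [integral_rpow_neg_three_halves_mul_exp hc]; positivity)

variable {V : Type*} [NormedAddCommGroup V] [InnerProductSpace ℝ V] [FiniteDimensional ℝ V]
  [MeasurableSpace V] [BorelSpace V]

theorem integrable_exp_neg_mul_sq_norm {a : ℝ} (ha : 0 < a) :
    Integrable fun x : V => Real.exp (-a * ‖x‖ ^ 2) := by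
  have h :=
    (GaussianFourier.integrable_cexp_neg_mul_sq_norm_add (V := V) (b := a) (by simpa) 0 0).norm
  refine h.congr (.of_forall fun x => ?_)
  simp only [zero_mul, add_zero, Complex.norm_exp]
  norm_cast

theorem integrable_clm_mul_exp_neg_mul_sq_norm {a : ℝ} (ha : 0 < a) (l : V →L[ℝ] ℝ) :
    Integrable fun x : V => l x * Real.exp (-a * ‖x‖ ^ 2) := by
  refine ((integrable_exp_neg_mul_sq_norm (half_pos ha)).const_mul (‖l‖ * (1 + 2 / a))).mono'
    (by fun_prop) (.of_forall fun x => ?_)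
  rw [norm_mul, Real.norm_of_nonneg (Real.exp_nonneg _)]
  calc ‖l x‖ * Real.exp (-a * ‖x‖ ^ 2) ≤ ‖l‖ * ‖x‖ * Real.exp (-a * ‖x‖ ^ 2) := by
        gcongr; exact l.le_opNorm x
    _ = ‖l‖ * (|‖x‖| * Real.exp (-a * ‖x‖ ^ 2)) := by rw [abs_norm, mul_assoc]
    _ ≤ ‖l‖ * ((1 + 2 / a) * Real.exp (-(a / 2) * ‖x‖ ^ 2)) := by
        exact mul_le_mul_of_nonneg_left (abs_mul_exp_neg_mul_sq_le ha _) (norm_nonneg _)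
    _ = _ := by ring

theorem norm_fourier_gaussian {a : ℝ} (ha : 0 < a) (ξ : V) :
    ‖𝓕 (fun x : V => ((Real.exp (-a * ‖x‖ ^ 2) : ℝ) : ℂ)) ξ‖ =
      (Real.pi / a) ^ (Module.finrank ℝ V / 2 : ℝ) * Real.exp (-(Real.pi ^ 2 * ‖ξ‖ ^ 2 / a)) := by
  have h := fourier_gaussian_innerProductSpace (V := V) (b := a) (by simpa) ξ
  have e : (fun x : V => ((Real.exp (-a * ‖x‖ ^ 2) : ℝ) : ℂ)) =
      fun v => Complex.exp (-(a : ℂ) * (‖v‖ : ℂ) ^ 2) := by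
    ext x; push_cast; rfl
  rw [e, h, norm_mul, Complex.norm_exp]
  congr 1
  · rw [← Complex.ofReal_div, show (Module.finrank ℝ V / 2 : ℂ) = ((Module.finrank ℝ V / 2 : ℝ) : ℂ)
      by push_cast; rfl, ← Complex.ofReal_cpow (by positivity), Complex.norm_real,
      Real.norm_of_nonneg (by positivity)]
  · congr 1
    rw [← neg_div]
    norm_cast
    simp [neg_mul]

theorem norm_fourier_inner_mul_gaussian {a : ℝ} (ha : 0 < a) (v ξ : V) :
    ‖𝓕 (fun x : V => ((inner ℝ v x * Real.exp (-a * ‖x‖ ^ 2) : ℝ) : ℂ)) ξ‖ =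
      Real.pi * |inner ℝ v ξ| / a * ((Real.pi / a) ^ (Module.finrank ℝ V / 2 : ℝ) *
        Real.exp (-(Real.pi ^ 2 * ‖ξ‖ ^ 2 / a))) := by
  set G : V → ℂ := fun x => ((Real.exp (-a * ‖x‖ ^ 2) : ℝ) : ℂ) with hG
  have hd : ∀ x, HasFDerivAt G
      (Complex.ofRealCLM.comp (Real.exp (-a * ‖x‖ ^ 2) • (-a) • (2 : ℕ) • innerSL ℝ x)) x := by
    intro x
    have h1 : HasFDerivAt (fun x : V => Real.exp (-a * ‖x‖ ^ 2))
        (Real.exp (-a * ‖x‖ ^ 2) • (-a) • (2 : ℕ) • innerSL ℝ x) x := by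
      have := ((hasStrictFDerivAt_norm_sq x).hasFDerivAt.const_mul (-a)).exp
      simpa using this
    exact Complex.ofRealCLM.hasFDerivAt.comp x h1
  have hf : fderiv ℝ G = fun x =>
      Complex.ofRealCLM.comp (Real.exp (-a * ‖x‖ ^ 2) • (-a) • (2 : ℕ) • innerSL ℝ x) :=
    funext fun x => (hd x).fderiv
  have hGi : Integrable G := (integrable_exp_neg_mul_sq_norm ha).ofReal
  have hfi : Integrable (fderiv ℝ G) := by
    rw [hf]
    refine ((integrable_exp_neg_mul_sq_norm (half_pos ha)).const_mul (2 * a * (1 + 2 / a))).mono'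
      (Continuous.aestronglyMeasurable (by fun_prop)) (.of_forall fun x => ?_)
    refine (ContinuousLinearMap.opNorm_comp_le _ _).trans ?_
    rw [Complex.ofRealCLM_norm, one_mul, norm_smul, norm_smul, norm_neg, ← Nat.cast_smul_eq_nsmul ℝ,
      norm_smul, innerSL_apply_norm, Real.norm_of_nonneg (Real.exp_nonneg _),
      Real.norm_of_nonneg ha.le]
    calc _ = 2 * a * (|‖x‖| * Real.exp (-a * ‖x‖ ^ 2)) := by
          rw [abs_norm]; norm_num; ring
      _ ≤ 2 * a * ((1 + 2 / a) * Real.exp (-(a / 2) * ‖x‖ ^ 2)) :=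
          mul_le_mul_of_nonneg_left (abs_mul_exp_neg_mul_sq_le ha _) (by positivity)
      _ = _ := by ring
  have h1 := Real.fourier_fderiv hGi (fun x => (hd x).differentiableAt) hfi
  have h2 := Real.fourier_continuousLinearMap_apply (a := v) (v := ξ) hfi
  rw [h1] at h2
  have h3 : (fun x => fderiv ℝ G x v) = fun x =>
      (-(2 * a) : ℂ) • ((inner ℝ v x * Real.exp (-a * ‖x‖ ^ 2) : ℝ) : ℂ) := by
    ext x
    rw [hf]
    simp [real_inner_comm]
    ring
  rw [h3] at h2
  have h4 : 𝓕 (fun x => (-(2 * a) : ℂ) • ((inner ℝ v x * Real.exp (-a * ‖x‖ ^ 2) : ℝ) : ℂ)) ξ =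
    (-(2 * a) : ℂ) • 𝓕 (fun x => ((inner ℝ v x * Real.exp (-a * ‖x‖ ^ 2) : ℝ) : ℂ)) ξ := by
    rw [Real.fourier_eq, Real.fourier_eq, ← integral_smul]
    exact integral_congr_ae (.of_forall fun x => smul_comm _ _ _)
  rw [h4] at h2
  have h5 := congrArg norm h2
  rw [VectorFourier.fourierSMulRight_apply, norm_smul, norm_smul, norm_smul, norm_neg, norm_neg]
    at h5
  simp only [neg_apply, norm_neg, Complex.norm_mul,
    Complex.norm_ofNat, Complex.norm_real, Complex.norm_I, Real.norm_eq_abs,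
    abs_of_pos Real.pi_pos, abs_of_pos ha, mul_one] at h5
  have h6 : |(innerSL ℝ ξ : V → ℝ) v| = |inner ℝ v ξ| := by rw [real_inner_comm]; rfl
  erw [h6] at h5
  rw [← norm_fourier_gaussian ha ξ, div_mul_eq_mul_div, eq_div_iff ha.ne', mul_comm]
  linarith

end Gaussian

section TruncatedKernel

open scoped FourierTransform
open Filter Topology

/-- The weight of `x_j exp (-s ‖x‖ ^ 2)` in the Gaussian superposition of the Riesz kernel. -/
noncomputable def rieszWeight (n : ℕ) (s : ℝ) : ℝ :=
  s ^ (((n : ℝ) - 1) / 2) / Real.pi ^ (((n : ℝ) + 1) / 2)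

/-- The Riesz kernel is a superposition of the functions `x_j exp (-s ‖x‖ ^ 2)`; this is the
contribution of the scales `s ∈ [a, b]`. -/
noncomputable def truncatedRieszKernel (n : ℕ) (j : Fin n) (a b : ℝ)
    (x : EuclideanSpace ℝ (Fin n)) : ℝ :=
  ∫ s in Icc a b, rieszWeight n s * (x j * Real.exp (-s * ‖x‖ ^ 2))

variable {n : ℕ} (j : Fin n) {a b : ℝ}

theorem rieszWeight_nonneg (n : ℕ) {s : ℝ} (hs : 0 ≤ s) : 0 ≤ rieszWeight n s := by
  unfold rieszWeight; positivity

theorem measurable_rieszWeight (n : ℕ) : Measurable (rieszWeight n) := by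
  unfold rieszWeight; fun_prop

theorem continuousOn_rieszWeight (n : ℕ) (ha : 0 < a) : ContinuousOn (rieszWeight n) (Icc a b) :=
  (continuousOn_id.rpow_const fun _ hs => .inl (ha.trans_le hs.1).ne').div_const _

theorem integrable_rieszWeight_mul (ha : 0 < a) :
    Integrable (fun z : ℝ × EuclideanSpace ℝ (Fin n) =>
      rieszWeight n z.1 * (z.2 j * Real.exp (-z.1 * ‖z.2‖ ^ 2)))
      ((volume.restrict (Icc a b)).prod volume) := by
  obtain ⟨W, hW⟩ := isCompact_Icc.exists_bound_of_continuousOn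
    (continuousOn_rieszWeight n ha (b := b))
  have hG := (integrable_clm_mul_exp_neg_mul_sq_norm ha
    (EuclideanSpace.proj j : EuclideanSpace ℝ (Fin n) →L[ℝ] ℝ)).norm
  have hm := measurable_rieszWeight n
  refine ((integrable_const (μ := volume.restrict (Icc a b)) W).mul_prod hG).mono'
    (Measurable.aestronglyMeasurable (by fun_prop)) ?_
  have hae : ∀ᵐ z ∂(volume.restrict (Icc a b)).prod (volume : Measure (EuclideanSpace ℝ (Fin n))),
      z.1 ∈ Icc a b :=
    Measure.quasiMeasurePreserving_fst.ae (ae_restrict_mem measurableSet_Icc)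
  filter_upwards [hae] with z hz
  rw [norm_mul, norm_mul, norm_mul]
  refine mul_le_mul (hW _ hz) ?_ (by positivity) ((norm_nonneg _).trans (hW _ hz))
  refine mul_le_mul_of_nonneg_left ?_ (norm_nonneg _)
  rw [Real.norm_of_nonneg (Real.exp_nonneg _), Real.norm_of_nonneg (Real.exp_nonneg _)]
  gcongr
  exact hz.1

theorem integrable_truncatedRieszKernel (ha : 0 < a) :
    Integrable (truncatedRieszKernel n j a b) :=
  (integrable_rieszWeight_mul j ha).integral_prod_right

theorem truncatedRieszKernel_eq (x : EuclideanSpace ℝ (Fin n)) :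
    truncatedRieszKernel n j a b x =
      x j * ∫ s in Icc a b, rieszWeight n s * Real.exp (-s * ‖x‖ ^ 2) := by
  rw [truncatedRieszKernel, ← integral_const_mul]
  congr 1 with s
  ring

theorem integrableOn_rieszWeight (n : ℕ) (ha : 0 < a) : IntegrableOn (rieszWeight n) (Icc a b) :=
  (continuousOn_rieszWeight n ha).integrableOn_Icc

theorem continuous_truncatedRieszKernel (ha : 0 < a) :
    Continuous (truncatedRieszKernel n j a b) := by
  rw [funext (truncatedRieszKernel_eq j)]
  refine Continuous.mul (by fun_prop) (continuous_of_dominated (bound := rieszWeight n)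
    (fun x => ?_) (fun x => ?_) (integrableOn_rieszWeight n ha) ?_)
  · have hm := measurable_rieszWeight n
    exact Measurable.aestronglyMeasurable (by fun_prop)
  · filter_upwards [ae_restrict_mem measurableSet_Icc] with s hs
    have hs0 : 0 ≤ s := ha.le.trans hs.1
    rw [Real.norm_of_nonneg (mul_nonneg (rieszWeight_nonneg n hs0) (Real.exp_nonneg _))]
    refine mul_le_of_le_one_right (rieszWeight_nonneg n hs0) (Real.exp_le_one_iff.2 ?_)
    nlinarith [mul_nonneg hs0 (sq_nonneg ‖x‖)]
  · exact .of_forall fun s => by fun_prop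

theorem exists_abs_truncatedRieszKernel_le (ha : 0 < a) :
    ∃ B, ∀ x, |truncatedRieszKernel n j a b x| ≤ B := by
  refine ⟨∫ s in Icc a b, rieszWeight n s * (1 + 2 / a), fun x => ?_⟩
  rw [truncatedRieszKernel, ← Real.norm_eq_abs]
  refine norm_integral_le_of_norm_le ((integrableOn_rieszWeight n ha).mul_const (1 + 2 / a)) ?_
  filter_upwards [ae_restrict_mem measurableSet_Icc] with s hs
  have hs0 : 0 ≤ s := ha.le.trans hs.1
  rw [norm_mul, Real.norm_of_nonneg (rieszWeight_nonneg n hs0), norm_mul,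
    Real.norm_of_nonneg (Real.exp_nonneg _)]
  refine mul_le_mul_of_nonneg_left ?_ (rieszWeight_nonneg n hs0)
  calc ‖x j‖ * Real.exp (-s * ‖x‖ ^ 2) ≤ |‖x‖| * Real.exp (-a * ‖x‖ ^ 2) := by
        rw [abs_norm]
        gcongr
        · exact EuclideanSpace.abs_apply_le_norm x j
        · exact hs.1
    _ ≤ (1 + 2 / a) * Real.exp (-(a / 2) * ‖x‖ ^ 2) := abs_mul_exp_neg_mul_sq_le ha _
    _ ≤ _ := mul_le_of_le_one_right (by positivity) (Real.exp_le_one_iff.2 (by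
        have : 0 ≤ a / 2 * ‖x‖ ^ 2 := by positivity
        linarith))

theorem integral_rieszWeight_mul_exp (n : ℕ) {r : ℝ} (hr : 0 < r) :
    ∫ s in Ioi 0, rieszWeight n s * Real.exp (-s * r ^ 2) = rieszConst n / r ^ (n + 1) := by
  have h := Real.integral_rpow_mul_exp_neg_mul_Ioi (a := ((n : ℝ) + 1) / 2) (by positivity)
    (pow_pos hr 2)
  have e : ∀ s, rieszWeight n s * Real.exp (-s * r ^ 2) =
      s ^ (((n : ℝ) + 1) / 2 - 1) * Real.exp (-(r ^ 2 * s)) / Real.pi ^ (((n : ℝ) + 1) / 2) := by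
    intro s
    rw [rieszWeight, show ((n : ℝ) + 1) / 2 - 1 = ((n : ℝ) - 1) / 2 by ring]
    ring_nf
  simp_rw [e]
  have e2 : (1 / r ^ 2) ^ (((n : ℝ) + 1) / 2) = (r ^ (n + 1))⁻¹ := by
    rw [one_div, Real.inv_rpow (by positivity), ← Real.rpow_natCast r 2, ← Real.rpow_mul hr.le,
      ← Real.rpow_natCast r (n + 1)]
    push_cast
    ring_nf
  rw [integral_div, h, rieszConst, e2]
  ring

theorem integrableOn_rieszWeight_mul_exp (n : ℕ) {r : ℝ} (hr : 0 < r) :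
    IntegrableOn (fun s => rieszWeight n s * Real.exp (-s * r ^ 2)) (Ioi 0) :=
  .of_integral_ne_zero (by
    rw [integral_rieszWeight_mul_exp n hr]
    have := rieszConst_pos n
    positivity)

theorem abs_truncatedRieszKernel_le (ha : 0 < a) {x : EuclideanSpace ℝ (Fin n)} (hx : x ≠ 0) :
    |truncatedRieszKernel n j a b x| ≤ |rieszKernel n j x| := by
  have hx' : 0 < ‖x‖ := norm_pos_iff.2 hx
  have hsub : Icc a b ⊆ Ioi 0 := fun s hs => ha.trans_le hs.1
  have hnn : ∀ s ∈ Ioi (0 : ℝ), 0 ≤ rieszWeight n s * Real.exp (-s * ‖x‖ ^ 2) := fun s hs =>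
    mul_nonneg (rieszWeight_nonneg n (le_of_lt hs)) (Real.exp_nonneg _)
  rw [truncatedRieszKernel_eq, rieszKernel, mul_div_left_comm, ← integral_rieszWeight_mul_exp n hx',
    abs_mul, abs_mul,
    abs_of_nonneg (setIntegral_nonneg measurableSet_Icc fun s hs => hnn s (hsub hs)),
    abs_of_nonneg (setIntegral_nonneg measurableSet_Ioi hnn)]
  refine mul_le_mul_of_nonneg_left ?_ (abs_nonneg _)
  exact setIntegral_mono_set (integrableOn_rieszWeight_mul_exp n hx')
    ((ae_restrict_mem measurableSet_Ioi).mono hnn) hsub.eventuallyLE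

theorem tendsto_truncatedRieszKernel {x : EuclideanSpace ℝ (Fin n)} (hx : x ≠ 0) :
    Tendsto (fun m : ℕ => truncatedRieszKernel n j (1 / ((m : ℝ) + 1)) ((m : ℝ) + 1) x) atTop
      (𝓝 (rieszKernel n j x)) := by
  have hx' : 0 < ‖x‖ := norm_pos_iff.2 hx
  have hU : (⋃ m : ℕ, Icc (1 / ((m : ℝ) + 1)) ((m : ℝ) + 1)) = Ioi 0 := by
    ext s
    simp only [mem_iUnion, mem_Icc, mem_Ioi]
    refine ⟨fun ⟨m, hm, _⟩ => lt_of_lt_of_le (by positivity) hm, fun hs => ?_⟩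
    obtain ⟨m, hm⟩ := exists_nat_ge (max s (1 / s))
    have h1 := (le_max_left _ _).trans hm
    have h2 := (le_max_right _ _).trans hm
    refine ⟨m, ?_, by linarith⟩
    rw [div_le_iff₀ (by positivity), ← div_le_iff₀' hs]
    linarith
  simp_rw [truncatedRieszKernel_eq]
  rw [rieszKernel, mul_div_left_comm, ← integral_rieszWeight_mul_exp n hx', ← hU]
  refine (tendsto_setIntegral_of_monotone (fun _ => measurableSet_Icc) (fun m k hmk => ?_)
    (by rw [hU]; exact integrableOn_rieszWeight_mul_exp n hx')).const_mul _
  have : (m : ℝ) ≤ k := by exact_mod_cast hmk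
  exact Icc_subset_Icc (by gcongr) (by gcongr)

theorem norm_fourier_truncatedRieszKernel_le (ha : 0 < a) (hab : a ≤ b)
    (ξ : EuclideanSpace ℝ (Fin n)) :
    ‖𝓕 (fun x => (truncatedRieszKernel n j a b x : ℂ)) ξ‖ ≤
      Real.sqrt 2 * Real.exp (-(Real.pi ^ 2 * ‖ξ‖ ^ 2 / (2 * b))) := by
  have hb : 0 < b := ha.trans_le hab
  have hswap : 𝓕 (fun x => (truncatedRieszKernel n j a b x : ℂ)) ξ =
      ∫ s in Icc a b, (rieszWeight n s : ℂ) * 𝓕 (fun x : EuclideanSpace ℝ (Fin n) =>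
        ((inner ℝ (EuclideanSpace.single j 1) x * Real.exp (-s * ‖x‖ ^ 2) : ℝ) : ℂ)) ξ := by
    have hInt : Integrable (fun z : EuclideanSpace ℝ (Fin n) × ℝ => 𝐞 (-inner ℝ z.1 ξ) •
        ((rieszWeight n z.2 * (z.1 j * Real.exp (-z.2 * ‖z.1‖ ^ 2)) : ℝ) : ℂ))
        (volume.prod (volume.restrict (Icc a b))) := by
      have hm := measurable_rieszWeight n
      refine (integrable_rieszWeight_mul j ha).swap.norm.mono' ?_ (.of_forall fun z => ?_)
      · have hc : Continuous fun z : EuclideanSpace ℝ (Fin n) × ℝ => 𝐞 (-inner ℝ z.1 ξ) :=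
          Real.continuous_fourierChar.comp (by fun_prop)
        exact hc.aestronglyMeasurable.smul (Measurable.aestronglyMeasurable (by fun_prop))
      · rw [Circle.norm_smul, Complex.norm_real]; rfl
    calc 𝓕 (fun x => (truncatedRieszKernel n j a b x : ℂ)) ξ
        = ∫ x, ∫ s in Icc a b, 𝐞 (-inner ℝ x ξ) •
          ((rieszWeight n s * (x j * Real.exp (-s * ‖x‖ ^ 2)) : ℝ) : ℂ) := by
          rw [Real.fourier_eq]
          congr 1 with x
          simp only [Circle.smul_def]
          rw [integral_smul, integral_complex_ofReal, truncatedRieszKernel]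
      _ = ∫ s in Icc a b, ∫ x, 𝐞 (-inner ℝ x ξ) •
          ((rieszWeight n s * (x j * Real.exp (-s * ‖x‖ ^ 2)) : ℝ) : ℂ) :=
          integral_integral_swap hInt
      _ = _ := by
          congr 1 with s
          rw [Real.fourier_eq, ← integral_const_mul]
          congr 1 with x
          rw [EuclideanSpace.inner_single_left, Complex.ofReal_mul (rieszWeight n s),
            mul_smul_comm]
          simp
  have hsub : Icc a b ⊆ Ioi 0 := fun s hs => ha.trans_le hs.1
  rcases eq_or_ne ξ 0 with rfl | hξ
  · have : ‖∫ s in Icc a b, (rieszWeight n s : ℂ) * 𝓕 (fun x : EuclideanSpace ℝ (Fin n) =>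
        ((inner ℝ (EuclideanSpace.single j 1) x * Real.exp (-s * ‖x‖ ^ 2) : ℝ) : ℂ)) 0‖ ≤ 0 := by
      rw [setIntegral_congr_fun (g := fun _ => (0 : ℂ)) measurableSet_Icc fun s hs => ?_]
      · simp
      · have h := norm_fourier_inner_mul_gaussian (hsub hs) (EuclideanSpace.single j (1 : ℝ)) 0
        rw [inner_zero_right, abs_zero, mul_zero, zero_div, zero_mul, norm_eq_zero] at h
        simp only [h, mul_zero]
    rw [hswap]
    exact this.trans (by positivity)
  have hξ' : 0 < ‖ξ‖ := norm_pos_iff.2 hξ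
  set c := Real.pi ^ 2 * ‖ξ‖ ^ 2 / 2 with hc
  have hc0 : 0 < c := by positivity
  set M := Real.sqrt Real.pi * ‖ξ‖ * Real.exp (-(c / b)) with hM
  have hb1 : ∀ s ∈ Icc a b, ‖(rieszWeight n s : ℂ) * 𝓕 (fun x : EuclideanSpace ℝ (Fin n) =>
        ((inner ℝ (EuclideanSpace.single j 1) x * Real.exp (-s * ‖x‖ ^ 2) : ℝ) : ℂ)) ξ‖ ≤
      M * (s ^ (-(3 / 2) : ℝ) * Real.exp (-(c / s))) := by
    intro s hs
    have hs0 : 0 < s := hsub hs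
    rw [norm_mul, norm_fourier_inner_mul_gaussian hs0, Complex.norm_real,
      Real.norm_of_nonneg (rieszWeight_nonneg n hs0.le), finrank_euclideanSpace_fin,
      EuclideanSpace.inner_single_left, map_one, one_mul]
    have hw : rieszWeight n s * (Real.pi / s * (Real.pi / s) ^ ((n : ℝ) / 2)) =
        Real.sqrt Real.pi * s ^ (-(3 / 2) : ℝ) := by
      rw [rieszWeight, Real.div_rpow Real.pi_pos.le hs0.le,
        show ((n : ℝ) - 1) / 2 = n / 2 + 1 + -(3 / 2) by ring,
        show ((n : ℝ) + 1) / 2 = n / 2 + 1 / 2 by ring, Real.rpow_add hs0, Real.rpow_add hs0,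
        Real.rpow_add Real.pi_pos, ← Real.sqrt_eq_rpow, Real.rpow_one]
      have hp : Real.sqrt Real.pi * Real.sqrt Real.pi = Real.pi := Real.mul_self_sqrt Real.pi_pos.le
      field_simp
      rw [sq, hp]
    have he : Real.exp (-(Real.pi ^ 2 * ‖ξ‖ ^ 2 / s)) ≤
        Real.exp (-(c / b)) * Real.exp (-(c / s)) := by
      rw [← Real.exp_add]
      refine Real.exp_le_exp.2 ?_
      have h1 : c / b ≤ c / s := by gcongr; exact hs.2
      have h2 : Real.pi ^ 2 * ‖ξ‖ ^ 2 / s = c / s + c / s := by rw [hc]; ring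
      linarith
    calc _ = rieszWeight n s * (Real.pi / s * (Real.pi / s) ^ ((n : ℝ) / 2)) *
          |ξ j| * Real.exp (-(Real.pi ^ 2 * ‖ξ‖ ^ 2 / s)) := by ring
      _ ≤ (Real.sqrt Real.pi * s ^ (-(3 / 2) : ℝ)) * ‖ξ‖ *
          (Real.exp (-(c / b)) * Real.exp (-(c / s))) := by
          rw [hw]
          gcongr
          exact EuclideanSpace.abs_apply_le_norm ξ j
      _ = _ := by rw [hM]; ring
  rw [hswap]
  calc _ ≤ ∫ s in Icc a b, M * (s ^ (-(3 / 2) : ℝ) * Real.exp (-(c / s))) :=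
        norm_integral_le_of_norm_le
          (((integrableOn_rpow_neg_three_halves_mul_exp hc0).mono_set hsub).const_mul M)
          ((ae_restrict_mem measurableSet_Icc).mono hb1)
    _ = M * ∫ s in Icc a b, s ^ (-(3 / 2) : ℝ) * Real.exp (-(c / s)) := integral_const_mul _ _
    _ ≤ M * ∫ s in Ioi 0, s ^ (-(3 / 2) : ℝ) * Real.exp (-(c / s)) := by
        refine mul_le_mul_of_nonneg_left ?_ (by positivity)
        refine setIntegral_mono_set (integrableOn_rpow_neg_three_halves_mul_exp hc0)
          ((ae_restrict_mem measurableSet_Ioi).mono fun s hs => ?_) hsub.eventuallyLE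
        have : 0 < s := hs
        simp only [Pi.zero_apply]
        positivity
    _ = _ := by
        rw [integral_rpow_neg_three_halves_mul_exp hc0, hM]
        have h1 : Real.pi / c = 2 / (Real.pi * ‖ξ‖ ^ 2) := by rw [hc]; field_simp
        rw [h1, Real.sqrt_div zero_le_two, Real.sqrt_mul Real.pi_pos.le, Real.sqrt_sq hξ'.le]
        have h2 : c / b = Real.pi ^ 2 * ‖ξ‖ ^ 2 / (2 * b) := by rw [hc]; field_simp
        rw [h2]
        field_simp

end TruncatedKernel

section L2Bound

open scoped FourierTransform Convolution
open Filter Topology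

variable {n : ℕ} (j : Fin n)

theorem lintegral_sq_setIntegral_truncatedRieszKernel_le {S : Set (EuclideanSpace ℝ (Fin n))}
    (hS : MeasurableSet S) (hSf : volume S ≠ ⊤) {a b : ℝ} (ha : 0 < a) (hab : a ≤ b) :
    ∫⁻ x, ENNReal.ofReal (|∫ y in S, truncatedRieszKernel n j a b (x - y)| ^ 2) ≤
      2 * volume S := by
  have hb : 0 < 2 * b := mul_pos two_pos (ha.trans_le hab)
  set f : EuclideanSpace ℝ (Fin n) → ℂ := S.indicator fun _ => 1 with hf
  set k : EuclideanSpace ℝ (Fin n) → ℂ := fun x => (truncatedRieszKernel n j a b x : ℂ) with hk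
  set A : ℝ := (Real.pi / (2 * b)) ^ ((n : ℝ) / 2) with hA
  have hA0 : 0 < A := by positivity
  set G : EuclideanSpace ℝ (Fin n) → ℂ := fun x => ((Real.exp (-(2 * b) * ‖x‖ ^ 2) : ℝ) : ℂ) with hG
  set g : EuclideanSpace ℝ (Fin n) → ℂ := fun x => (A⁻¹ : ℂ) * G x with hg
  have hGi : Integrable G := (integrable_exp_neg_mul_sq_norm hb).ofReal
  have hGc : Continuous G := by fun_prop
  have hGn : ∀ x, ‖G x‖ = Real.exp (-(2 * b) * ‖x‖ ^ 2) := fun x => by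
    rw [hG, Complex.norm_real, Real.norm_of_nonneg (Real.exp_nonneg _)]
  have hAn : ‖(A⁻¹ : ℂ)‖ = A⁻¹ := by
    rw [norm_inv, Complex.norm_real, Real.norm_of_nonneg hA0.le]
  have hFg : ∀ ξ, ‖𝓕 g ξ‖ = Real.exp (-(Real.pi ^ 2 * ‖ξ‖ ^ 2 / (2 * b))) := by
    intro ξ
    have h1 : 𝓕 g ξ = (A⁻¹ : ℂ) * 𝓕 G ξ := by
      rw [Real.fourier_eq, Real.fourier_eq, ← integral_const_mul]
      refine integral_congr_ae (.of_forall fun x => ?_)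
      simp only [hg, Circle.smul_def, smul_eq_mul]
      ring
    rw [h1, norm_mul, hAn, norm_fourier_gaussian hb, finrank_euclideanSpace_fin, ← hA,
      inv_mul_cancel_left₀ hA0.ne']
  have hgi : Integrable g := hGi.const_mul _
  have hFc : Continuous (𝓕 g) :=
    VectorFourier.fourierIntegral_continuous Real.continuous_fourierChar
      (by exact continuous_inner) hgi
  have hFgi : Integrable (𝓕 g) := by
    have h := integrable_exp_neg_mul_sq_norm (V := EuclideanSpace ℝ (Fin n))
      (a := Real.pi ^ 2 / (2 * b)) (by positivity)
    refine h.mono' hFc.aestronglyMeasurable (.of_forall fun ξ => ?_)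
    rw [hFg]
    exact (congrArg Real.exp (by ring)).le
  have hfi : Integrable f := (integrable_indicator_iff hS).2 (integrableOn_const hSf)
  obtain ⟨B, hB⟩ := exists_abs_truncatedRieszKernel_le (n := n) j (b := b) ha
  have key := lintegral_norm_sq_convolution_le (f := f) (k := k) (g := g) (C := Real.sqrt 2) hfi
    (fun x => by by_cases hx : x ∈ S <;> simp [hf, hx])
    (integrable_truncatedRieszKernel j ha).ofReal
    (Complex.continuous_ofReal.comp (continuous_truncatedRieszKernel j ha))
    (Bk := B) (fun x => by rw [hk, Complex.norm_real]; exact hB x)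
    hgi (continuous_const.mul hGc) (Bg := A⁻¹) (fun x => by
      rw [norm_mul, hAn, hGn]
      exact mul_le_of_le_one_right (by positivity) (Real.exp_le_one_iff.2 (by
        have : 0 ≤ 2 * b * ‖x‖ ^ 2 := by positivity
        linarith)))
    (by
      simp_rw [hg, norm_mul, hAn, hGn]
      rw [integral_const_mul, GaussianFourier.integral_rexp_neg_mul_sq_norm hb,
        finrank_euclideanSpace_fin, ← hA, inv_mul_cancel₀ hA0.ne'])
    hFgi (fun ξ => by rw [hFg]; exact norm_fourier_truncatedRieszKernel_le j ha hab ξ)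
  have hconv : ∀ x, ‖(f ⋆[ContinuousLinearMap.mul ℂ ℂ] k) x‖ =
      |∫ y in S, truncatedRieszKernel n j a b (x - y)| := by
    intro x
    have h1 : (f ⋆[ContinuousLinearMap.mul ℂ ℂ] k) x = ∫ y in S, k (x - y) := by
      rw [convolution_def, ← integral_indicator hS]
      congr 1 with y
      by_cases hy : y ∈ S <;> simp [hf, hy]
    rw [h1, hk, integral_complex_ofReal, Complex.norm_real, Real.norm_eq_abs]
  simp_rw [hconv] at key
  refine key.trans_eq ?_
  have hnf : (fun x => ‖f x‖) = S.indicator fun _ => (1 : ℝ) := by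
    ext x
    by_cases hx : x ∈ S <;> simp [hf, hx]
  rw [hnf, integral_indicator_const _ hS, Real.sq_sqrt zero_le_two, smul_eq_mul, mul_one,
    ENNReal.ofReal_mul zero_le_two, ENNReal.ofReal_ofNat, Measure.real, ENNReal.ofReal_toReal hSf]

theorem abs_rieszKernel_le_inv_pow {δ : ℝ} (hδ : 0 < δ) {z : EuclideanSpace ℝ (Fin n)}
    (hz : δ ≤ ‖z‖) : |rieszKernel n j z| ≤ rieszConst n * (δ ^ n)⁻¹ := by
  have hz0 : 0 < ‖z‖ := hδ.trans_le hz
  have hc := rieszConst_pos n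
  rw [rieszKernel, abs_mul, abs_of_pos hc, abs_div, abs_of_pos (pow_pos hz0 _)]
  refine mul_le_mul_of_nonneg_left ?_ hc.le
  calc |z j| / ‖z‖ ^ (n + 1) ≤ ‖z‖ / ‖z‖ ^ (n + 1) := by
        gcongr; exact EuclideanSpace.abs_apply_le_norm _ j
    _ = (‖z‖ ^ n)⁻¹ := by rw [pow_succ]; field_simp
    _ ≤ (δ ^ n)⁻¹ := by gcongr

theorem lintegral_sq_setIntegral_rieszKernel_le
    {S D : Set (EuclideanSpace ℝ (Fin n))} (hS : MeasurableSet S) (hSf : volume S ≠ ⊤)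
    (hD : MeasurableSet D) {δ : ℝ} (hδ : 0 < δ) (hδS : ∀ x ∈ D, ∀ y ∈ S, δ ≤ ‖x - y‖) :
    ∫⁻ x in D, ENNReal.ofReal (|∫ y in S, rieszKernel n j (x - y)| ^ 2) ≤ 2 * volume S := by
  set K : ℕ → EuclideanSpace ℝ (Fin n) → ℝ := fun m =>
    truncatedRieszKernel n j (1 / ((m : ℝ) + 1)) ((m : ℝ) + 1)
  have hpos : ∀ m : ℕ, 0 < 1 / ((m : ℝ) + 1) := fun m => by positivity
  have hle : ∀ m : ℕ, 1 / ((m : ℝ) + 1) ≤ (m : ℝ) + 1 := fun m => by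
    rw [div_le_iff₀ (by positivity)]
    nlinarith [(Nat.cast_nonneg m : (0 : ℝ) ≤ m)]
  have hne : ∀ x ∈ D, ∀ y ∈ S, x - y ≠ 0 := fun x hx y hy =>
    norm_pos_iff.1 (hδ.trans_le (hδS x hx y hy))
  have hKc : ∀ m, Continuous (K m) := fun m => continuous_truncatedRieszKernel j (hpos m)
  have hbd : ∀ x ∈ D, ∀ y ∈ S, |rieszKernel n j (x - y)| ≤ rieszConst n * (δ ^ n)⁻¹ :=
    fun x hx y hy =>
    abs_rieszKernel_le_inv_pow j hδ (hδS x hx y hy)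
  have hlim : ∀ x ∈ D, Tendsto (fun m => ∫ y in S, K m (x - y)) atTop
      (𝓝 (∫ y in S, rieszKernel n j (x - y))) := by
    intro x hx
    refine tendsto_integral_of_dominated_convergence (fun _ => rieszConst n * (δ ^ n)⁻¹)
      (fun m => ((hKc m).comp (by fun_prop)).aestronglyMeasurable)
      (integrableOn_const hSf) (fun m => ?_) ?_
    · filter_upwards [ae_restrict_mem hS] with y hy
      exact (abs_truncatedRieszKernel_le j (hpos m) (hne x hx y hy)).trans (hbd x hx y hy)
    · filter_upwards [ae_restrict_mem hS] with y hy
      exact tendsto_truncatedRieszKernel j (hne x hx y hy)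
  have hmeas : ∀ m, Measurable fun x => ∫ y in S, K m (x - y) := fun m =>
    (StronglyMeasurable.integral_prod_right (f := fun x y => K m (x - y))
      (((hKc m).comp (by fun_prop)).stronglyMeasurable)).measurable
  calc ∫⁻ x in D, ENNReal.ofReal (|∫ y in S, rieszKernel n j (x - y)| ^ 2)
      = ∫⁻ x in D, liminf (fun m => ENNReal.ofReal (|∫ y in S, K m (x - y)| ^ 2)) atTop := by
        refine setLIntegral_congr_fun hD fun x hx => ?_
        have h := ((hlim x hx).abs.pow 2)
        exact ((ENNReal.continuous_ofReal.tendsto _).comp h).liminf_eq.symm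
    _ ≤ liminf (fun m => ∫⁻ x in D, ENNReal.ofReal (|∫ y in S, K m (x - y)| ^ 2)) atTop :=
        lintegral_liminf_le fun m => by
          have := hmeas m
          fun_prop
    _ ≤ 2 * volume S := by
        refine liminf_le_of_frequently_le' (Frequently.of_forall fun m => ?_)
        exact (setLIntegral_le_lintegral _ _).trans
          (lintegral_sq_setIntegral_truncatedRieszKernel_le j hS hSf (hpos m) (hle m))

end L2Bound

section WeakType

variable {n : ℕ} (j : Fin n)

theorem lintegral_lintegral_rieszKernel_sub_le (hn : 2 ≤ n) {c : EuclideanSpace ℝ (Fin n)} {r : ℝ}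
    {S D : Set (EuclideanSpace ℝ (Fin n))} (hS : S ⊆ Metric.ball c r)
    (hSm : MeasurableSet S) (hDm : MeasurableSet D) (hD : ∀ x ∈ D, (1 + (n : ℝ)⁻¹) * r ≤ ‖x - c‖) :
    ∫⁻ x in D, ∫⁻ y in S, ‖rieszKernel n j (x - c) - rieszKernel n j (x - y)‖ₑ ≤
      ENNReal.ofReal (14 * Real.log n) * volume S := by
  have hK := measurable_rieszKernel n j
  rw [lintegral_lintegral_swap (Measurable.aemeasurable (by fun_prop)), ← setLIntegral_const]
  refine setLIntegral_mono' hSm fun y hy => ?_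
  have hyr : ‖y - c‖ < r := mem_ball_iff_norm.1 (hS hy)
  set T := {z : EuclideanSpace ℝ (Fin n) | (1 + (n : ℝ)⁻¹) * r ≤ ‖z‖} with hT
  have hTm : MeasurableSet T := measurableSet_le measurable_const measurable_norm
  set F : EuclideanSpace ℝ (Fin n) → ENNReal := fun z =>
    ‖rieszKernel n j z - rieszKernel n j (z - (y - c))‖ₑ with hF
  calc ∫⁻ x in D, ‖rieszKernel n j (x - c) - rieszKernel n j (x - y)‖ₑ
      = ∫⁻ x in D, F (x - c) := by simp only [hF, sub_sub_sub_cancel_right]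
    _ ≤ ∫⁻ x, T.indicator F (x - c) := by
        refine (setLIntegral_mono' (g := fun x => T.indicator F (x - c)) hDm fun x hx => ?_).trans
          (setLIntegral_le_lintegral D _)
        rw [indicator_of_mem (show x - c ∈ T from hD x hx)]
    _ = ∫⁻ z in T, F z := by
        rw [lintegral_sub_right_eq_self (T.indicator F) c, lintegral_indicator hTm]
    _ ≤ _ := by
        simp_rw [hF, Real.enorm_eq_ofReal_abs]
        exact lintegral_abs_rieszKernel_sub_le hn j hyr

theorem integrableOn_rieszKernel_sub {S : Set (EuclideanSpace ℝ (Fin n))} (hS : MeasurableSet S)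
    (hSf : volume S ≠ ⊤) {x : EuclideanSpace ℝ (Fin n)} {δ : ℝ} (hδ : 0 < δ)
    (hx : ∀ y ∈ S, δ ≤ ‖x - y‖) : IntegrableOn (fun y => rieszKernel n j (x - y)) S := by
  have hK := measurable_rieszKernel n j
  refine Measure.integrableOn_of_bounded (M := rieszConst n * (δ ^ n)⁻¹) hSf
    (Measurable.aestronglyMeasurable (by fun_prop)) ?_
  filter_upwards [ae_restrict_mem hS] with y hy
  exact abs_rieszKernel_le_inv_pow j hδ (hx y hy)

theorem lintegral_rieszDirac_sub_le (hn : 2 ≤ n) {lam : ℝ} (hlam : 0 < lam) {N : ℕ}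
    {c : Fin N → EuclideanSpace ℝ (Fin n)} {a : Fin N → ℝ} (ha : ∀ k, 0 < a k) {r : Fin N → ℝ}
    {S : Fin N → Set (EuclideanSpace ℝ (Fin n))} (hSm : ∀ k, MeasurableSet (S k))
    (hS : ∀ k, S k ⊆ Metric.ball (c k) (r k)) (hSd : Pairwise (Function.onFun Disjoint S))
    (hSv : ∀ k, volume (S k) = ENNReal.ofReal (a k / lam)) {D : Set (EuclideanSpace ℝ (Fin n))}
    (hDm : MeasurableSet D)
    (hD : ∀ k, ∀ x ∈ D, (1 + (n : ℝ)⁻¹) * r k ≤ ‖x - c k‖) {δ : ℝ} (hδ : 0 < δ)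
    (hDS : ∀ k, ∀ x ∈ D, ∀ y ∈ S k, δ ≤ ‖x - y‖) :
    ∫⁻ x in D, ‖rieszDirac n j c a x - lam * ∫ y in ⋃ k, S k, rieszKernel n j (x - y)‖ₑ ≤
      ENNReal.ofReal (14 * Real.log n * ∑ k, a k) := by
  have hK := measurable_rieszKernel n j
  have hfin : ∀ k, volume (S k) ≠ ⊤ := fun k => by rw [hSv]; exact ENNReal.ofReal_ne_top
  have hpt : ∀ x ∈ D, ‖rieszDirac n j c a x - lam * ∫ y in ⋃ k, S k, rieszKernel n j (x - y)‖ₑ ≤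
      ∑ k, ENNReal.ofReal lam *
        ∫⁻ y in S k, ‖rieszKernel n j (x - c k) - rieszKernel n j (x - y)‖ₑ := by
    intro x hx
    have hInt : ∀ k, IntegrableOn (fun y => rieszKernel n j (x - y)) (S k) := fun k =>
      integrableOn_rieszKernel_sub j (hSm k) (hfin k) hδ (hDS k x hx)
    have heq : rieszDirac n j c a x - lam * ∫ y in ⋃ k, S k, rieszKernel n j (x - y) =
        ∑ k, lam * ∫ y in S k, (rieszKernel n j (x - c k) - rieszKernel n j (x - y)) := by
      rw [integral_iUnion_fintype hSm hSd hInt, rieszDirac_eq_sum, Finset.mul_sum,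
        ← Finset.sum_sub_distrib]
      refine Finset.sum_congr rfl fun k _ => ?_
      have hconst : Integrable (fun _ => rieszKernel n j (x - c k)) (volume.restrict (S k)) :=
        integrableOn_const (hfin k)
      rw [integral_sub hconst (hInt k), setIntegral_const, Measure.real,
        hSv, ENNReal.toReal_ofReal (div_nonneg (ha k).le hlam.le), smul_eq_mul]
      field_simp
    rw [heq]
    refine (enorm_sum_le _ _).trans (Finset.sum_le_sum fun k _ => ?_)
    rw [enorm_mul, Real.enorm_of_nonneg hlam.le]
    gcongr
    exact enorm_integral_le_lintegral_enorm _
  have hmeas : ∀ k, Measurable fun x =>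
      ∫⁻ y in S k, ‖rieszKernel n j (x - c k) - rieszKernel n j (x - y)‖ₑ := fun k =>
    Measurable.lintegral_prod_right' (f := fun p : EuclideanSpace ℝ (Fin n) × _ =>
      ‖rieszKernel n j (p.1 - c k) - rieszKernel n j (p.1 - p.2)‖ₑ) (by fun_prop)
  calc _ ≤ ∫⁻ x in D, ∑ k, ENNReal.ofReal lam *
        ∫⁻ y in S k, ‖rieszKernel n j (x - c k) - rieszKernel n j (x - y)‖ₑ :=
        setLIntegral_mono' hDm hpt
    _ = ∑ k, ENNReal.ofReal lam * ∫⁻ x in D,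
        ∫⁻ y in S k, ‖rieszKernel n j (x - c k) - rieszKernel n j (x - y)‖ₑ := by
        rw [lintegral_finsetSum _ fun k _ => (hmeas k).const_mul _]
        exact Finset.sum_congr rfl fun k _ => lintegral_const_mul _ (hmeas k)
    _ ≤ ∑ k, ENNReal.ofReal (14 * Real.log n * a k) := by
        refine Finset.sum_le_sum fun k _ => ?_
        have hlog : 0 ≤ Real.log n := Real.log_natCast_nonneg n
        refine (mul_le_mul_right
          (lintegral_lintegral_rieszKernel_sub_le j hn (hS k) (hSm k) hDm (hD k)) _).trans_eq ?_
        rw [hSv, ← ENNReal.ofReal_mul (by positivity), ← ENNReal.ofReal_mul hlam.le]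
        congr 1
        field_simp
    _ = _ := by
        have hlog : 0 ≤ Real.log n := Real.log_natCast_nonneg n
        rw [← ENNReal.ofReal_sum_of_nonneg fun k _ => mul_nonneg (by positivity) (ha k).le,
          Finset.mul_sum]

end WeakType

theorem measurable_rieszDirac (n : ℕ) (j : Fin n) {N : ℕ} (c : Fin N → EuclideanSpace ℝ (Fin n))
    (a : Fin N → ℝ) : Measurable (rieszDirac n j c a) := by
  unfold rieszDirac
  fun_prop

/-- Dimensional weak-type (1,1) bound, with constant `C log n`, for the Riesz
transform applied to a finite nonnegative linear combination of Dirac masses. -/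
theorem riesz_dirac_weak_type_log_bound :
    ∃ C : ℝ, 0 < C ∧
      ∀ (n : ℕ), 2 ≤ n → ∀ (j : Fin n), ∀ lam : ℝ, 0 < lam →
        ∀ (N : ℕ) (c : Fin N → EuclideanSpace ℝ (Fin n)) (a : Fin N → ℝ),
          (∀ k, 0 < a k) →
          ENNReal.ofReal lam *
              volume {x : EuclideanSpace ℝ (Fin n) | lam < |rieszDirac n j c a x|} ≤
            ENNReal.ofReal (C * Real.log n * ∑ k, a k) := by
  refine ⟨50, by norm_num, fun n hn j lam hlam N c a ha => ?_⟩
  have hnpos : (0 : ℝ) < n := by exact_mod_cast (by omega : 0 < n)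
  have : Nonempty (Fin n) := ⟨j⟩
  obtain ⟨r, S, hr, hSm, hS, hSd, hSU, hSv⟩ := exists_disjoint_pieces
    (volume : Measure (EuclideanSpace ℝ (Fin n))) N c (fun k => a k / lam)
    fun k => div_pos (ha k) hlam
  set U := ⋃ k, S k with hU
  set A := ∑ k, a k with hA
  have hA0 : 0 ≤ A := Finset.sum_nonneg fun k _ => (ha k).le
  have hUm : MeasurableSet U := MeasurableSet.iUnion hSm
  have hUv : volume U ≤ ENNReal.ofReal (A / lam) := by
    refine (measure_iUnion_fintype_le _ _).trans_eq ?_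
    simp_rw [hSv]
    rw [← ENNReal.ofReal_sum_of_nonneg fun k _ => (div_pos (ha k) hlam).le, hA, Finset.sum_div]
  have hUf : volume U ≠ ⊤ := ne_top_of_le_ne_top ENNReal.ofReal_ne_top hUv
  set s : ℝ := 1 + (n : ℝ)⁻¹ with hs
  have hs1 : 1 ≤ s := le_add_of_nonneg_right (by positivity)
  set B := ⋃ k, Metric.ball (c k) (s * r k) with hB
  have hBm : MeasurableSet B := MeasurableSet.iUnion fun k => measurableSet_ball
  have hBv : volume B ≤ 3 * ENNReal.ofReal (A / lam) := by
    refine (measure_iUnion_ball_dilate_le volume c r hs1).trans ?_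
    rw [finrank_euclideanSpace_fin, ← hSU]
    gcongr
    rw [← ENNReal.ofReal_ofNat 3]
    exact ENNReal.ofReal_le_ofReal (one_add_inv_pow_le_three (by omega))
  have hD : ∀ k, ∀ x ∈ Bᶜ, s * r k ≤ ‖x - c k‖ := by
    intro k x hx
    by_contra! h
    exact hx (mem_iUnion.2 ⟨k, mem_ball_iff_norm.2 h⟩)
  obtain ⟨δ, hδ, hδr⟩ : ∃ δ : ℝ, 0 < δ ∧ ∀ k, δ ≤ (n : ℝ)⁻¹ * r k := by
    rcases isEmpty_or_nonempty (Fin N) with h | h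
    · exact ⟨1, one_pos, fun k => isEmptyElim k⟩
    · obtain ⟨k, hk⟩ := Finite.exists_min fun k => (n : ℝ)⁻¹ * r k
      exact ⟨_, mul_pos (inv_pos.2 hnpos) (hr k), hk⟩
  have hDS : ∀ k, ∀ x ∈ Bᶜ, ∀ y ∈ S k, δ ≤ ‖x - y‖ := by
    intro k x hx y hy
    have h1 := hD k x hx
    have h2 : ‖y - c k‖ < r k := mem_ball_iff_norm.1 (hS k hy)
    have h3 : ‖x - c k‖ ≤ ‖x - y‖ + ‖y - c k‖ := norm_sub_le_norm_sub_add_norm_sub _ _ _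
    have h4 := hδr k
    rw [hs, add_mul] at h1
    linarith
  set G : EuclideanSpace ℝ (Fin n) → ℝ := fun x => ∫ y in U, rieszKernel n j (x - y) with hG
  have hGm : Measurable G := by
    have hK := measurable_rieszKernel n j
    exact (StronglyMeasurable.integral_prod_right (f := fun x y => rieszKernel n j (x - y))
      (Measurable.stronglyMeasurable (by fun_prop))).measurable
  have hRm := measurable_rieszDirac n j c a
  have hG2 : volume (Bᶜ ∩ {x | 1 / 2 ≤ |G x|}) ≤ 8 * ENNReal.ofReal (A / lam) := by
    have hbd := lintegral_sq_setIntegral_rieszKernel_le j hUm hUf hBm.compl hδ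
      fun x hx y hy => by
        obtain ⟨k, hk⟩ := mem_iUnion.1 hy
        exact hDS k x hx y hk
    have hm : Measurable fun x => ENNReal.ofReal (|G x| ^ 2) := by fun_prop
    have hch := mul_meas_ge_le_lintegral (μ := volume.restrict Bᶜ) hm (ENNReal.ofReal (1 / 4))
    have hsub : Bᶜ ∩ {x | 1 / 2 ≤ |G x|} ⊆
        {x | ENNReal.ofReal (1 / 4) ≤ ENNReal.ofReal (|G x| ^ 2)} ∩ Bᶜ := by
      rintro x ⟨hx, hx2⟩
      have hx2 : 1 / 2 ≤ |G x| := hx2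
      exact ⟨ENNReal.ofReal_le_ofReal (by nlinarith), hx⟩
    rw [Measure.restrict_apply (measurableSet_le measurable_const hm)] at hch
    have h4 : (8 : ENNReal) = 4 * 2 := by norm_num
    have h5 : (4 : ENNReal) * ENNReal.ofReal (1 / 4) = 1 := by
      rw [← ENNReal.ofReal_ofNat 4, ← ENNReal.ofReal_mul (by norm_num)]
      norm_num
    calc _ ≤ 4 * (ENNReal.ofReal (1 / 4) *
          volume ({x | ENNReal.ofReal (1 / 4) ≤ ENNReal.ofReal (|G x| ^ 2)} ∩ Bᶜ)) := by
          rw [← mul_assoc, h5, one_mul]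
          exact measure_mono hsub
      _ ≤ 4 * (2 * volume U) := by exact mul_le_mul_right (hch.trans hbd) _
      _ ≤ _ := by rw [← mul_assoc, ← h4]; gcongr
  have hR1 : ENNReal.ofReal (lam / 2) *
      volume (Bᶜ ∩ {x | lam / 2 ≤ |rieszDirac n j c a x - lam * G x|}) ≤
      ENNReal.ofReal (14 * Real.log n * A) := by
    have hm : Measurable fun x => ‖rieszDirac n j c a x - lam * G x‖ₑ := by fun_prop
    refine le_trans ?_ ((mul_meas_ge_le_lintegral (μ := volume.restrict Bᶜ) hm
      (ENNReal.ofReal (lam / 2))).trans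
        (lintegral_rieszDirac_sub_le j hn hlam ha hSm hS hSd hSv hBm.compl hD hδ hDS))
    rw [Measure.restrict_apply (measurableSet_le measurable_const hm)]
    refine mul_le_mul_right (measure_mono ?_) _
    rintro x ⟨hx, hx2⟩
    refine ⟨?_, hx⟩
    change ENNReal.ofReal (lam / 2) ≤ ‖rieszDirac n j c a x - lam * G x‖ₑ
    rw [Real.enorm_eq_ofReal_abs]
    exact ENNReal.ofReal_le_ofReal hx2
  have hcover : {x | lam < |rieszDirac n j c a x|} ⊆ B ∪ (Bᶜ ∩ {x | 1 / 2 ≤ |G x|}) ∪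
      (Bᶜ ∩ {x | lam / 2 ≤ |rieszDirac n j c a x - lam * G x|}) := by
    intro x hx
    have hx : lam < |rieszDirac n j c a x| := hx
    by_cases hxB : x ∈ B
    · exact Or.inl (Or.inl hxB)
    by_cases hxG : 1 / 2 ≤ |G x|
    · exact Or.inl (Or.inr ⟨hxB, hxG⟩)
    refine Or.inr ⟨hxB, ?_⟩
    have h1 := abs_sub_abs_le_abs_sub (rieszDirac n j c a x) (lam * G x)
    rw [abs_mul, abs_of_pos hlam] at h1
    change lam / 2 ≤ |rieszDirac n j c a x - lam * G x|
    nlinarith [not_le.1 hxG]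
  have hlog : 0.69 ≤ Real.log n := by
    have h2 : Real.log 2 ≤ Real.log n := Real.log_le_log two_pos (by exact_mod_cast hn)
    linarith [Real.log_two_gt_d9]
  have hlamA : ENNReal.ofReal lam * ENNReal.ofReal (A / lam) = ENNReal.ofReal A := by
    rw [← ENNReal.ofReal_mul hlam.le, mul_div_cancel₀ _ hlam.ne']
  have hlam2 : ENNReal.ofReal lam = 2 * ENNReal.ofReal (lam / 2) := by
    rw [← ENNReal.ofReal_ofNat 2, ← ENNReal.ofReal_mul two_pos.le, mul_div_cancel₀ _ two_ne_zero]
  set W := Bᶜ ∩ {x | lam / 2 ≤ |rieszDirac n j c a x - lam * G x|}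
  calc _ ≤ ENNReal.ofReal lam * (3 * ENNReal.ofReal (A / lam) + 8 * ENNReal.ofReal (A / lam) +
        volume W) := by
        gcongr
        refine (measure_mono hcover).trans ((measure_union_le _ _).trans ?_)
        gcongr
        exact (measure_union_le _ _).trans (add_le_add hBv hG2)
    _ = 11 * (ENNReal.ofReal lam * ENNReal.ofReal (A / lam)) +
        2 * (ENNReal.ofReal (lam / 2) * volume W) := by
        rw [← mul_assoc 2, ← hlam2]
        ring
    _ ≤ 11 * ENNReal.ofReal A + 2 * ENNReal.ofReal (14 * Real.log n * A) := by
        rw [hlamA]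
        gcongr
    _ = ENNReal.ofReal (11 * A + 2 * (14 * Real.log n * A)) := by
        have hlog0 : 0 ≤ Real.log n := Real.log_natCast_nonneg n
        rw [ENNReal.ofReal_add (by positivity) (by positivity),
          ENNReal.ofReal_mul (p := 11) (by norm_num), ENNReal.ofReal_mul (p := 2) (by norm_num),
          ENNReal.ofReal_ofNat, ENNReal.ofReal_ofNat]
    _ ≤ _ := ENNReal.ofReal_le_ofReal (by nlinarith)
end
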